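/- Let g : (ℂⁿ, 0) → (ℂⁿ, 0) be a germ of a finite holomorphic map. Let X be a germ of an analytic hypersurface that has an isolated singularity at 0. Then the preimage g⁻¹(X) is singular at 0. -/

import Mathlib

open Set Filter Topology

noncomputable section

/-- `ℂⁿ`, modeled as the space of functions `Fin n → ℂ`. -/
abbrev Cn (n : ℕ) : Type := Fin n → ℂ

/-- `X` is an analytic hypersurface in the open set `W`, with its reduced structure:
near every point of `W` it is the zero set of a holomorphic function that does not
vanish identically on a connected neighborhood (hence every irreducible component of
`X` has codimension one). -/
def IsHypersurfaceIn {n : ℕ} (W X : Set (Cn n)) : Prop :=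
  X ⊆ W ∧ ∀ p ∈ W, ∃ V : Set (Cn n), IsOpen V ∧ IsPreconnected V ∧ p ∈ V ∧ V ⊆ W ∧
    ∃ ψ : Cn n → ℂ, AnalyticOnNhd ℂ ψ V ∧ (∃ x ∈ V, ψ x ≠ 0) ∧ X ∩ V = {x ∈ V | ψ x = 0}

/-- A hypersurface `X` is smooth at `p` if near `p` it is a codimension-one complex
submanifold of `ℂⁿ`, i.e. the zero set of a holomorphic function submersive at `p`.
"`X` is singular at `p`" is the negation of this. -/
def SmoothPointAt {n : ℕ} (X : Set (Cn n)) (p : Cn n) : Prop :=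
  ∃ (V : Set (Cn n)) (φ : Cn n → ℂ), IsOpen V ∧ p ∈ V ∧ AnalyticOnNhd ℂ φ V ∧
    fderiv ℂ φ p ≠ 0 ∧ X ∩ V = {x ∈ V | φ x = 0}

section

open scoped ContDiff

theorem norm_fderiv_apply_le {n : ℕ} {f : Cn n → ℂ} {x v : Cn n} {r C : ℝ} (hr : 0 < r)
    (hv : ‖v‖ ≤ 1) (hf : ∀ y ∈ Metric.closedBall x r, DifferentiableAt ℂ f y)
    (hC : ∀ y ∈ Metric.closedBall x r, ‖f y‖ ≤ C) : ‖fderiv ℂ f x v‖ ≤ C / r := by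
  have hmem : ∀ z ∈ Metric.closedBall (0 : ℂ) r, x + z • v ∈ Metric.closedBall x r := by
    intro z hz
    simp only [Metric.mem_closedBall, dist_zero_right, dist_self_add_left, norm_smul] at hz ⊢
    calc ‖z‖ * ‖v‖ ≤ r * 1 := by gcongr
      _ = r := mul_one r
  have hl : ∀ z : ℂ, HasDerivAt (fun z : ℂ => x + z • v) v z := fun z => by
    simpa using ((hasDerivAt_id z).smul_const v).const_add x
  have hd : ∀ z ∈ Metric.closedBall (0 : ℂ) r,
      HasDerivAt (fun z : ℂ => f (x + z • v)) (fderiv ℂ f (x + z • v) v) z := fun z hz =>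
    (hf _ (hmem z hz)).hasFDerivAt.comp_hasDerivAt z (hl z)
  have h0 := (hd 0 (by simp [hr.le])).deriv
  simp only [zero_smul, add_zero] at h0
  rw [← h0]
  refine Complex.norm_deriv_le_of_forall_mem_sphere_norm_le hr ?_ ?_
  · refine DifferentiableOn.diffContOnCl fun z hz => ?_
    rw [closure_ball _ hr.ne'] at hz
    exact (hd z hz).differentiableAt.differentiableWithinAt
  · intro z hz
    exact hC _ (hmem z (Metric.sphere_subset_closedBall hz))

theorem clm_apply_eq_sum {n : ℕ} (L : Cn n →L[ℂ] ℂ) (v : Cn n) :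
    L v = ∑ i, L (Pi.single i 1) * v i := by
  conv_lhs => rw [← Finset.univ_sum_single v, map_sum]
  refine Finset.sum_congr rfl fun i _ => ?_
  have : Pi.single i (v i) = v i • (Pi.single i 1 : Cn n) := by
    rw [← Pi.single_smul, smul_eq_mul, mul_one]
  rw [this, map_smul, smul_eq_mul, mul_comm]

theorem differentiableOn_intervalIntegral {n : ℕ} {F : Cn n → ℝ → ℂ} {a b : ℝ} {s : Set (Cn n)}
    (hs : IsOpen s) (hc : ContinuousOn (fun q : Cn n × ℝ => F q.1 q.2) (s ×ˢ uIcc a b))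
    (hd : ∀ t ∈ uIcc a b, DifferentiableOn ℂ (fun y => F y t) s) :
    DifferentiableOn ℂ (fun y => ∫ t in a..b, F y t) s := by
  intro x hx
  obtain ⟨r, hr, hrs⟩ := Metric.nhds_basis_closedBall.mem_iff.1 (hs.mem_nhds hx)
  obtain ⟨C, hC⟩ := ((isCompact_closedBall x r).prod (isCompact_uIcc (a := a) (b := b))
    ).exists_bound_of_continuousOn (hc.mono (prod_mono hrs subset_rfl))
  have hC0 : ∀ y ∈ Metric.closedBall x r, ∀ t ∈ uIcc a b, ‖F y t‖ ≤ C :=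
    fun y hy t ht => hC (y, t) ⟨hy, ht⟩
  have hda : ∀ t ∈ uIcc a b, ∀ y ∈ s, DifferentiableAt ℂ (fun y => F y t) y :=
    fun t ht y hy => (hd t ht).differentiableAt (hs.mem_nhds hy)
  have hct : ∀ y ∈ s, ContinuousOn (F y) (uIcc a b) := fun y hy =>
    hc.comp (f := fun t : ℝ => (y, t)) (by fun_prop) fun t ht => ⟨hy, ht⟩
  have hmeas : ∀ y ∈ s, MeasureTheory.AEStronglyMeasurable (F y)
      (MeasureTheory.volume.restrict (uIoc a b)) := fun y hy =>
    ((hct y hy).mono uIoc_subset_uIcc).aestronglyMeasurable measurableSet_uIoc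
  have hxs : ∀ y ∈ Metric.ball x (r / 2), Metric.closedBall y (r / 2) ⊆ Metric.closedBall x r := by
    intro y hy
    refine Metric.closedBall_subset_closedBall' ?_
    have := Metric.mem_ball.1 hy
    linarith
  have hCnn : ∀ t ∈ uIcc a b, 0 ≤ C := fun t ht =>
    (norm_nonneg _).trans (hC0 x (Metric.mem_closedBall_self hr.le) t ht)
  refine (intervalIntegral.hasFDerivAt_integral_of_dominated_of_fderiv_le
    (F' := fun y t => fderiv ℂ (fun y => F y t) y) (bound := fun _ => C / (r / 2))
    (Metric.ball_mem_nhds x (half_pos hr)) ?_ ?_ ?_ ?_ ?_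
      ?_).differentiableAt.differentiableWithinAt
  · filter_upwards [hs.mem_nhds hx] with y hy using hmeas y hy
  · exact (hct x hx).intervalIntegrable
  · have key : ∀ i : Fin n, MeasureTheory.AEStronglyMeasurable
        (fun t => fderiv ℂ (fun y => F y t) x (Pi.single i 1))
        (MeasureTheory.volume.restrict (uIoc a b)) := by
      intro i
      obtain ⟨u, hu0, hut⟩ : ∃ u : ℕ → ℂ, (∀ k, u k ≠ 0 ∧ x + u k • Pi.single i 1 ∈ s) ∧
          Tendsto u atTop (𝓝[≠] 0) := by
        have h1 : ∀ᶠ z : ℂ in 𝓝[≠] 0, x + z • (Pi.single i 1 : Cn n) ∈ s := by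
          have : Tendsto (fun z : ℂ => x + z • (Pi.single i 1 : Cn n)) (𝓝[≠] 0) (𝓝 x) := by
            have : Continuous (fun z : ℂ => x + z • (Pi.single i 1 : Cn n)) := by fun_prop
            simpa using (this.tendsto 0).mono_left nhdsWithin_le_nhds
          exact this (hs.mem_nhds hx)
        obtain ⟨u, hu⟩ := exists_seq_tendsto (𝓝[≠] (0 : ℂ))
        have h2 := hu.eventually (h1.and self_mem_nhdsWithin)
        obtain ⟨N, hN⟩ := eventually_atTop.1 h2
        exact ⟨fun k => u (k + N), fun k => ⟨(hN _ (by omega)).2, (hN _ (by omega)).1⟩,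
          hu.comp (tendsto_add_atTop_nat N)⟩
      refine aestronglyMeasurable_of_tendsto_ae atTop
        (f := fun k t => (u k)⁻¹ * (F (x + u k • Pi.single i 1) t - F x t)) ?_ ?_
      · intro k
        exact ((hmeas _ (hu0 k).2).sub (hmeas x hx)).const_mul _
      · refine (MeasureTheory.ae_restrict_iff' measurableSet_uIoc).2 (.of_forall fun t ht => ?_)
        have h3 : HasDerivAt (fun z : ℂ => F (x + z • Pi.single i 1) t)
            (fderiv ℂ (fun y => F y t) x (Pi.single i 1)) 0 := by
          have := (hda t (uIoc_subset_uIcc ht) x hx).hasFDerivAt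
          refine HasFDerivAt.comp_hasDerivAt (f := fun z : ℂ => x + z • (Pi.single i 1 : Cn n))
            (l := fun y => F y t) (0 : ℂ) (by simpa using this) ?_
          simpa using ((hasDerivAt_id (0 : ℂ)).smul_const (Pi.single i 1 : Cn n)).const_add x
        have := (hasDerivAt_iff_tendsto_slope_zero.1 h3).comp hut
        simpa [Function.comp_def] using this
    have : (fun t => fderiv ℂ (fun y => F y t) x) = fun t => ∑ i : Fin n,
        (fderiv ℂ (fun y => F y t) x (Pi.single i 1)) •
          (ContinuousLinearMap.proj i : Cn n →L[ℂ] ℂ) := by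
      funext t
      ext v
      simpa using clm_apply_eq_sum _ v
    rw [this]
    refine Finset.aestronglyMeasurable_fun_sum _ fun i _ => ?_
    exact (key i).smul_const _
  · refine .of_forall fun t ht y hy => ?_
    have ht' := uIoc_subset_uIcc ht
    have hy' := hxs y hy
    refine ContinuousLinearMap.opNorm_le_of_unit_norm (div_nonneg (hCnn t ht') (half_pos hr).le)
      fun v hv => norm_fderiv_apply_le (half_pos hr) hv.le
        (fun z hz => hda t ht' z (hrs (hy' hz))) fun z hz => hC0 z (hy' hz) t ht'
  · exact intervalIntegrable_const
  · refine .of_forall fun t ht y hy => ?_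
    exact (hda t (uIoc_subset_uIcc ht) y (hrs (Metric.ball_subset_closedBall
      (Metric.ball_subset_ball (half_le_self hr.le) hy)))).hasFDerivAt

theorem differentiableOn_circleIntegral {n : ℕ} {F : Cn n → ℂ → ℂ} {c : ℂ} {r : ℝ} (hr : 0 ≤ r)
    {s : Set (Cn n)} (hs : IsOpen s)
    (hc : ContinuousOn (fun q : Cn n × ℂ => F q.1 q.2) (s ×ˢ Metric.sphere c r))
    (hd : ∀ z ∈ Metric.sphere c r, DifferentiableOn ℂ (fun y => F y z) s) :
    DifferentiableOn ℂ (fun y => ∮ z in C(c, r), F y z) s := by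
  refine differentiableOn_intervalIntegral hs ?_ fun t _ => ?_
  · simp only [deriv_circleMap, smul_eq_mul]
    refine ContinuousOn.mul (by fun_prop) ?_
    exact hc.comp (f := fun q : Cn n × ℝ => (q.1, circleMap c r q.2)) (by fun_prop)
      fun q hq => ⟨hq.1, circleMap_mem_sphere c hr _⟩
  · exact DifferentiableOn.fun_const_smul (hd _ (circleMap_mem_sphere c hr t))
      (deriv (circleMap c r) t)

theorem differentiableOn_fderiv_apply {n : ℕ} {f : Cn n → ℂ} {s : Set (Cn n)}
    (hs : IsOpen s) (hf : DifferentiableOn ℂ f s) (v : Cn n) :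
    DifferentiableOn ℂ (fun y => fderiv ℂ f y v) s := by
  intro x hx
  obtain ⟨ε, hε, hεs⟩ := Metric.mem_nhds_iff.1 (hs.mem_nhds hx)
  obtain ⟨r, hr, hrv⟩ : ∃ r : ℝ, 0 < r ∧ r * ‖v‖ < ε / 2 := by
    refine ⟨ε / 2 / (‖v‖ + 1), by positivity, ?_⟩
    rw [div_mul_eq_mul_div, div_lt_iff₀ (by positivity)]
    nlinarith [norm_nonneg v]
  have hmem : ∀ y ∈ Metric.ball x (ε / 2), ∀ z ∈ Metric.closedBall (0 : ℂ) r,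
      y + z • v ∈ s := by
    intro y hy z hz
    refine hεs ?_
    have h1 : dist (y + z • v) y ≤ r * ‖v‖ := by
      simp only [dist_self_add_left, norm_smul]
      have : ‖z‖ ≤ r := by simpa using hz
      gcongr
    have := dist_triangle (y + z • v) y x
    have := Metric.mem_ball.1 hy
    simp only [Metric.mem_ball]
    linarith
  have key : ∀ y ∈ Metric.ball x (ε / 2), fderiv ℂ f y v =
      (2 * (Real.pi : ℂ) * Complex.I)⁻¹ • ∮ z in C(0, r), ((z - 0) ^ 2)⁻¹ • f (y + z • v) := by
    intro y hy
    have hUo : IsOpen {z : ℂ | y + z • v ∈ s} :=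
      hs.preimage (by fun_prop : Continuous fun z : ℂ => y + z • v)
    rw [Complex.two_pi_I_inv_smul_circleIntegral_sub_sq_inv_smul_of_differentiable hUo
      (fun z hz => hmem y hy z hz) ?_ (Metric.mem_ball_self hr)]
    · have h0 : y ∈ s := by simpa using hmem y hy 0 (by simp [hr.le])
      have h1 := (hf.differentiableAt (hs.mem_nhds h0)).hasFDerivAt
      have := HasFDerivAt.comp_hasDerivAt (f := fun z : ℂ => y + z • v) (l := f) (0 : ℂ)
        (by simpa using h1) (f' := v)
        (by simpa using ((hasDerivAt_id (0 : ℂ)).smul_const v).const_add y)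
      exact this.deriv.symm
    · exact hf.comp (g := f) (f := fun z : ℂ => y + z • v)
        (by fun_prop) fun z hz => hz
  have hD : DifferentiableOn ℂ (fun y => (2 * (Real.pi : ℂ) * Complex.I)⁻¹ •
      ∮ z in C(0, r), ((z - 0) ^ 2)⁻¹ • f (y + z • v)) (Metric.ball x (ε / 2)) := by
    refine DifferentiableOn.fun_const_smul (differentiableOn_circleIntegral hr.le Metric.isOpen_ball
      ?_ fun z hz => ?_) _
    · simp only [smul_eq_mul]
      refine ContinuousOn.mul ?_ (hf.continuousOn.comp
        (f := fun q : Cn n × ℂ => q.1 + q.2 • v) (by fun_prop) ?_)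
      · refine ContinuousOn.inv₀ (by fun_prop) fun q hq => ?_
        have := hq.2
        simp only [mem_sphere_iff_norm, sub_zero] at this
        rw [sub_zero]
        refine pow_ne_zero 2 fun h => ?_
        rw [h, norm_zero] at this
        exact hr.ne this
      · exact fun q hq => hmem q.1 hq.1 q.2 (Metric.sphere_subset_closedBall hq.2)
    · exact DifferentiableOn.fun_const_smul (hf.comp (f := fun y => y + z • v) (by fun_prop)
        fun y hy => hmem y hy z (Metric.sphere_subset_closedBall hz)) _
  refine DifferentiableAt.differentiableWithinAt ?_
  have hn := Metric.ball_mem_nhds x (half_pos hε)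
  refine (hD.differentiableAt hn).congr_of_eventuallyEq ?_
  filter_upwards [hn] with y hy using key y hy

theorem contDiffOn_infty_of_isOpen {n : ℕ} {f : Cn n → ℂ} {s : Set (Cn n)}
    (hs : IsOpen s) (hf : DifferentiableOn ℂ f s) : ContDiffOn ℂ ∞ f s := by
  refine contDiffOn_infty.2 fun k => ?_
  induction k generalizing f with
  | zero => exact contDiffOn_zero.2 hf.continuousOn
  | succ k ih =>
    rw [Nat.cast_succ, contDiffOn_succ_iff_fderiv_of_isOpen hs]
    refine ⟨hf, fun h => absurd h (by simp), contDiffOn_clm_apply.2 fun v => ?_⟩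
    exact ih (differentiableOn_fderiv_apply hs hf v)

theorem contDiffAt_infty_of_eventually {n : ℕ} {f : Cn n → ℂ} {x : Cn n}
    (hf : ∀ᶠ y in 𝓝 x, DifferentiableAt ℂ f y) : ContDiffAt ℂ ∞ f x := by
  obtain ⟨s, hsf, hs, hx⟩ := eventually_nhds_iff.1 hf
  exact (contDiffOn_infty_of_isOpen hs
    fun y hy => (hsf y hy).differentiableWithinAt).contDiffAt (hs.mem_nhds hx)

theorem ContDiffAt.eventually_infty {n : ℕ} {f : Cn n → ℂ} {x : Cn n}
    (hf : ContDiffAt ℂ ∞ f x) : ∀ᶠ y in 𝓝 x, ContDiffAt ℂ ∞ f y := by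
  have h : ∀ᶠ y in 𝓝 x, DifferentiableAt ℂ f y :=
    ((hf.of_le (m := 1) (by exact_mod_cast le_top)).eventually (by simp)).mono fun _ h =>
    h.differentiableAt (by simp)
  exact h.eventually_nhds.mono fun y hy => contDiffAt_infty_of_eventually hy

theorem ContDiffAt.eventually_infty_pi {n m : ℕ} {f : Cn n → Cn m} {x : Cn n}
    (hf : ContDiffAt ℂ ∞ f x) : ∀ᶠ y in 𝓝 x, ContDiffAt ℂ ∞ f y := by
  have h : ∀ i, ∀ᶠ y in 𝓝 x, ContDiffAt ℂ ∞ (fun y => f y i) y := fun i =>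
    (contDiffAt_pi.1 hf i).eventually_infty
  exact (eventually_all.2 h).mono fun y hy => contDiffAt_pi.2 hy

open ComplexConjugate MeasureTheory

/-- The `a`-th complex partial derivative. -/
def pd {n : ℕ} (a : Fin n) (f : Cn n → ℂ) (y : Cn n) : ℂ := fderiv ℂ f y (Pi.single a 1)

/-- The sum of the squared moduli of a family of functions. -/
def nsq {n m : ℕ} (P : Fin m → Cn n → ℂ) (y : Cn n) : ℝ := ∑ l, Complex.normSq (P l y)

theorem setIntegral_hasLineDerivAt_eq_zero {n : ℕ} {r : ℝ} {u u' : Cn n → ℂ} {v : Cn n}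
    {K : Set (Cn n)} (hK : IsCompact K) (hKr : K ⊆ Metric.ball 0 r)
    (hu : ∀ y ∈ Metric.ball (0 : Cn n) r, HasLineDerivAt ℝ u (u' y) y v)
    (huc : ContinuousOn u (Metric.closedBall 0 r)) (huc' : ContinuousOn u' (Metric.closedBall 0 r))
    (h0 : ∀ y ∈ Metric.ball 0 r, y ∉ K → u y = 0) :
    ∫ y in Metric.ball (0 : Cn n) r, u' y = 0 := by
  set B := Metric.ball (0 : Cn n) r
  have hw0 : ∀ y ∉ K, B.indicator u y = 0 := fun y hy => by
    by_cases hyB : y ∈ B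
    · rw [indicator_of_mem hyB, h0 y hyB hy]
    · exact indicator_of_notMem hyB _
  have hline : ∀ (y : Cn n) (O : Set (Cn n)), IsOpen O → y ∈ O →
      ∀ᶠ t : ℝ in 𝓝 0, y + t • v ∈ O := by
    intro y O hO hy
    have : Continuous fun t : ℝ => y + t • v := by fun_prop
    exact this.continuousAt.preimage_mem_nhds (by simpa using hO.mem_nhds hy)
  have hder : ∀ y, HasLineDerivAt ℝ (B.indicator u) (B.indicator u' y) y v := by
    intro y
    have hz : y ∉ K → HasLineDerivAt ℝ (B.indicator u) 0 y v := fun hyK => by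
      refine HasDerivAt.congr_of_eventuallyEq (hasDerivAt_const (0 : ℝ) (0 : ℂ)) ?_
      filter_upwards [hline y _ hK.isClosed.isOpen_compl hyK] with t ht using hw0 _ ht
    by_cases hyB : y ∈ B
    · have : HasLineDerivAt ℝ (B.indicator u) (u' y) y v := by
        refine HasDerivAt.congr_of_eventuallyEq (hu y hyB) ?_
        filter_upwards [hline y _ Metric.isOpen_ball hyB] with t ht using indicator_of_mem ht _
      rwa [indicator_of_mem hyB]
    · rw [indicator_of_notMem hyB]
      exact hz fun h => hyB (hKr h)
  have hInt : ∀ f : Cn n → ℂ, ContinuousOn f (Metric.closedBall 0 r) →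
      Integrable (B.indicator f) := fun f hf =>
    ((hf.integrableOn_compact (isCompact_closedBall _ _)).mono_set
      Metric.ball_subset_closedBall).integrable_indicator measurableSet_ball
  have := integral_bilinear_hasLineDerivAt_right_eq_neg_left_of_integrable (μ := volume)
    (f := fun _ : Cn n => (1 : ℂ)) (f' := fun _ => 0) (B := ContinuousLinearMap.mul ℝ ℂ)
    (by simp) (by simpa using hInt u' huc') (by simpa using hInt u huc)
    (fun x _ => hasDerivAt_const _ _) (fun x _ => hder x)
  rw [← integral_indicator measurableSet_ball]
  simpa using this

theorem ContDiffAt.hasLineDerivAt_pd {n : ℕ} {f : Cn n → ℂ} {y : Cn n}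
    (hf : ContDiffAt ℂ ∞ f y) (a : Fin n) (c : ℂ) :
    HasLineDerivAt ℝ f (c * pd a f y) y (Pi.single a c) := by
  have h := ((hf.differentiableAt (by simp)).hasFDerivAt.restrictScalars ℝ).hasLineDerivAt
    (Pi.single a c)
  have h1 : (Pi.single a c : Cn n) = c • Pi.single a 1 := by
    rw [← Pi.single_smul, smul_eq_mul, mul_one]
  have h2 : (fderiv ℂ f y).restrictScalars ℝ (Pi.single a c : Cn n) = c * pd a f y := by
    rw [ContinuousLinearMap.coe_restrictScalars', h1, map_smul, smul_eq_mul, pd]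
  rwa [h2] at h

theorem HasDerivAt.normSq {f : ℝ → ℂ} {f' : ℂ} {t : ℝ} (hf : HasDerivAt f f' t) :
    HasDerivAt (fun s => Complex.normSq (f s)) (2 * (conj (f t) * f').re) t := by
  have hr := Complex.reCLM.hasFDerivAt.comp_hasDerivAt t hf
  have hi := Complex.imCLM.hasFDerivAt.comp_hasDerivAt t hf
  simp only [Complex.normSq_apply]
  refine ((hr.mul hr).add (hi.mul hi)).congr_deriv ?_
  simp
  ring

theorem HasDerivAt.conj_comp {f : ℝ → ℂ} {f' : ℂ} {t : ℝ} (hf : HasDerivAt f f' t) :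
    HasDerivAt (fun s => conj (f s)) (conj f') t :=
  Complex.conjCLE.toContinuousLinearMap.hasFDerivAt.comp_hasDerivAt t hf

theorem hasLineDerivAt_conj_mul_mul {n m : ℕ} {P : Fin m → Cn n → ℂ} {H W : Cn n → ℂ} {y : Cn n}
    (hP : ∀ l, ContDiffAt ℂ ∞ (P l) y) (hH : ContDiffAt ℂ ∞ H y) (hW : ContDiffAt ℂ ∞ W y)
    {ρ : ℝ → ℝ} (hρ : ContDiff ℝ ∞ ρ) (a : Fin n) (c : ℂ) :
    HasLineDerivAt ℝ (fun y => conj (H y) * W y * (ρ (nsq P y) : ℂ))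
      (conj (c * pd a H y) * W y * ρ (nsq P y) + conj (H y) * (c * pd a W y) * ρ (nsq P y)
        + conj (H y) * W y * (((deriv ρ (nsq P y) : ℝ) : ℂ) *
          ∑ l, (conj (P l y) * (c * pd a (P l) y) + P l y * conj (c * pd a (P l) y))))
      y (Pi.single a c) := by
  have hH' := (hH.hasLineDerivAt_pd a c).conj_comp
  have hW' := hW.hasLineDerivAt_pd a c
  have hS := HasDerivAt.fun_sum (u := Finset.univ)
    fun l _ => ((hP l).hasLineDerivAt_pd a c).normSq
  have hρ' : HasDerivAt ρ (deriv ρ (nsq P y)) (nsq P (y + (0 : ℝ) • (Pi.single a c : Cn n))) := by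
    rw [zero_smul, add_zero]
    exact ((hρ.differentiable (by simp)) _).hasDerivAt
  have h3 := (hρ'.comp (0 : ℝ) hS).ofReal_comp
  refine ((hH'.mul hW').mul h3).congr_deriv ?_
  simp only [zero_smul, add_zero]
  have : ∀ l, ((2 * (conj (P l y) * (c * pd a (P l) y)).re : ℝ) : ℂ) =
      conj (P l y) * (c * pd a (P l) y) + P l y * conj (c * pd a (P l) y) := by
    intro l
    rw [← Complex.add_conj, map_mul, Complex.conj_conj]
  push_cast at this ⊢
  simp only [this, nsq, Function.comp_def, zero_smul, add_zero, Pi.mul_apply]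
  ring

theorem contDiffAt_pd {n : ℕ} {f : Cn n → ℂ} {y : Cn n} (hf : ContDiffAt ℂ ∞ f y) (a : Fin n) :
    ContDiffAt ℂ ∞ (pd a f) y :=
  (hf.fderiv_right (m := ∞) (by simp)).clm_apply contDiffAt_const

theorem continuousOn_of_contDiffAt {n : ℕ} {f : Cn n → ℂ} {s : Set (Cn n)}
    (hf : ∀ y ∈ s, ContDiffAt ℂ ∞ f y) : ContinuousOn f s :=
  fun y hy => (hf y hy).continuousAt.continuousWithinAt

theorem continuousOn_nsq {n m : ℕ} {P : Fin m → Cn n → ℂ} {s : Set (Cn n)}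
    (hP : ∀ l, ContinuousOn (P l) s) : ContinuousOn (nsq P) s :=
  continuousOn_finsetSum _ fun l _ => Complex.continuous_normSq.comp_continuousOn (hP l)

theorem setIntegral_divergence_eq_zero {n m : ℕ} {r δ : ℝ} {P : Fin m → Cn n → ℂ}
    {H : Cn n → ℂ} {W : Fin n → Cn n → ℂ}
    (hP : ∀ l, ∀ y ∈ Metric.closedBall 0 r, ContDiffAt ℂ ∞ (P l) y)
    (hH : ∀ y ∈ Metric.closedBall 0 r, ContDiffAt ℂ ∞ H y)
    (hW : ∀ a, ∀ y ∈ Metric.closedBall 0 r, ContDiffAt ℂ ∞ (W a) y)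
    (hPδ : ∀ y ∈ Metric.sphere 0 r, δ < nsq P y)
    {ρ : ℝ → ℝ} (hρ : ContDiff ℝ ∞ ρ) (hρδ : ∀ s, δ < s → ρ s = 0) :
    ∫ y in Metric.ball (0 : Cn n) r, conj (H y) * ((∑ a, pd a (W a) y) * ρ (nsq P y) +
      ((deriv ρ (nsq P y) : ℝ) : ℂ) * ∑ l, conj (P l y) * ∑ a, pd a (P l) y * W a y) = 0 := by
  have hPc := fun l => continuousOn_of_contDiffAt (hP l)
  have hHc := continuousOn_of_contDiffAt hH
  have hWc := fun a => continuousOn_of_contDiffAt (hW a)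
  have hPd := fun l a => continuousOn_of_contDiffAt fun y hy => contDiffAt_pd (hP l y hy) a
  have hHd := fun a => continuousOn_of_contDiffAt fun y hy => contDiffAt_pd (hH y hy) a
  have hWd := fun b a => continuousOn_of_contDiffAt fun y hy => contDiffAt_pd (hW b y hy) a
  have hS := continuousOn_nsq hPc
  have hρc : ContinuousOn (fun y => (ρ (nsq P y) : ℂ)) (Metric.closedBall 0 r) :=
    Complex.continuous_ofReal.comp_continuousOn (hρ.continuous.comp_continuousOn hS)
  have hρd : ContinuousOn (fun y => ((deriv ρ (nsq P y) : ℝ) : ℂ)) (Metric.closedBall 0 r) :=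
    Complex.continuous_ofReal.comp_continuousOn
      ((hρ.continuous_deriv (by simp)).comp_continuousOn hS)
  have hconj : ∀ f : Cn n → ℂ, ContinuousOn f (Metric.closedBall 0 r) →
      ContinuousOn (fun y => conj (f y)) (Metric.closedBall 0 r) := fun f hf =>
    Complex.continuous_conj.comp_continuousOn hf
  set K : Set (Cn n) := Metric.closedBall 0 r ∩ nsq P ⁻¹' Iic δ
  have hK : IsCompact K := (isCompact_closedBall _ _).of_isClosed_subset
    (hS.preimage_isClosed_of_isClosed Metric.isClosed_closedBall isClosed_Iic) inter_subset_left
  have hKr : K ⊆ Metric.ball 0 r := by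
    intro y hy
    rcases (Metric.mem_closedBall.1 hy.1).lt_or_eq with h | h
    · exact h
    · exact absurd (hPδ y h) (not_lt.2 hy.2)
  set u' : Fin n → ℂ → Cn n → ℂ := fun a c y => conj (c * pd a H y) * W a y * ρ (nsq P y) +
    conj (H y) * (c * pd a (W a) y) * ρ (nsq P y) + conj (H y) * W a y *
      (((deriv ρ (nsq P y) : ℝ) : ℂ) *
      ∑ l, (conj (P l y) * (c * pd a (P l) y) + P l y * conj (c * pd a (P l) y))) with hu'
  have hu'c : ∀ a c, ContinuousOn (u' a c) (Metric.closedBall 0 r) := by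
    intro a c
    simp only [hu', map_mul]
    have h1 := hconj _ (hHd a)
    have h2 := hconj _ hHc
    have h3 := fun l => hconj _ (hPd l a)
    have h4 := fun l => hconj _ (hPc l)
    have h5 := hWc a
    have h6 := hWd a a
    have h7 := fun l => hPd l a
    refine ((((continuousOn_const.mul h1).mul h5).mul hρc).add
      ((h2.mul (continuousOn_const.mul h6)).mul hρc)).add ((h2.mul h5).mul (hρd.mul ?_))
    exact continuousOn_finsetSum _ fun l _ => ((h4 l).mul (continuousOn_const.mul (h7 l))).add
      ((hPc l).mul (continuousOn_const.mul (h3 l)))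
  have key : ∀ a c, ∫ y in Metric.ball (0 : Cn n) r, u' a c y = 0 := by
    intro a c
    refine setIntegral_hasLineDerivAt_eq_zero hK hKr (u := fun y => conj (H y) * W a y *
      (ρ (nsq P y) : ℂ)) (v := Pi.single a c) (fun y hy => ?_) ?_ (hu'c a c) fun y hy hyK => ?_
    · have hy' := Metric.ball_subset_closedBall hy
      exact hasLineDerivAt_conj_mul_mul (fun l => hP l y hy') (hH y hy') (hW a y hy') hρ a c
    · exact ((hconj _ hHc).mul (hWc a)).mul hρc
    · have : δ < nsq P y := not_le.1 fun h => hyK ⟨Metric.ball_subset_closedBall hy, h⟩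
      simp [hρδ _ this]
  have hInt : ∀ a c, IntegrableOn (u' a c) (Metric.ball 0 r) := fun a c =>
    ((hu'c a c).integrableOn_compact (isCompact_closedBall _ _)).mono_set
      Metric.ball_subset_closedBall
  have hsum : ∫ y in Metric.ball (0 : Cn n) r,
      ∑ a, (1 / 2 : ℂ) * (u' a 1 y - Complex.I * u' a Complex.I y) = 0 := by
    have h1 : ∀ a, IntegrableOn (fun y => (1 / 2 : ℂ) * (u' a 1 y - Complex.I * u' a Complex.I y))
        (Metric.ball 0 r) := fun a =>
      ((hInt a 1).sub ((hInt a Complex.I).const_mul Complex.I)).const_mul _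
    rw [integral_finsetSum _ fun a _ => h1 a]
    refine Finset.sum_eq_zero fun a _ => ?_
    rw [integral_const_mul, integral_sub (hInt a 1) ((hInt a Complex.I).const_mul Complex.I),
      integral_const_mul, key, key]
    simp
  rw [← hsum]
  congr 1
  funext y
  have hterm : ∀ a, (1 / 2 : ℂ) * (u' a 1 y - Complex.I * u' a Complex.I y) =
      conj (H y) * (pd a (W a) y * ρ (nsq P y) + ((deriv ρ (nsq P y) : ℝ) : ℂ) *
        ∑ l, conj (P l y) * (pd a (P l) y * W a y)) := by
    intro a
    have hs : ∑ l, conj (P l y) * (pd a (P l) y * W a y) =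
        (∑ l, conj (P l y) * pd a (P l) y) * W a y := by
      rw [Finset.sum_mul]
      exact Finset.sum_congr rfl fun l _ => by ring
    have h1 : ∀ c : ℂ, ∑ l, (conj (P l y) * (c * pd a (P l) y) + P l y * conj (c * pd a (P l) y))
        = c * (∑ l, conj (P l y) * pd a (P l) y) + conj c * ∑ l, P l y * conj (pd a (P l) y) := by
      intro c
      rw [Finset.mul_sum, Finset.mul_sum, ← Finset.sum_add_distrib]
      exact Finset.sum_congr rfl fun l _ => by rw [map_mul]; ring
    simp only [hu', h1, hs]
    simp only [map_mul, map_one, Complex.conj_I]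
    linear_combination (-(1 / 2 : ℂ) * (-conj (pd a H y) * W a y * ρ (nsq P y) +
      conj (H y) * pd a (W a) y * ρ (nsq P y) + conj (H y) * W a y * ((deriv ρ (nsq P y) : ℝ) : ℂ) *
      ((∑ l, conj (P l y) * pd a (P l) y) - ∑ l, P l y * conj (pd a (P l) y)))) * Complex.I_mul_I
  rw [Finset.sum_congr rfl fun a _ => hterm a, ← Finset.mul_sum, Finset.sum_add_distrib,
    ← Finset.sum_mul, ← Finset.mul_sum, Finset.sum_comm]
  simp only [Finset.mul_sum]

theorem ContDiffAt.hasDerivAt_pd {n : ℕ} {f : Cn n → ℂ} {y : Cn n}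
    (hf : ContDiffAt ℂ ∞ f y) (a : Fin n) :
    HasDerivAt (fun t : ℂ => f (y + t • Pi.single a 1)) (pd a f y) 0 :=
  (hf.differentiableAt (by simp)).hasFDerivAt.hasLineDerivAt (Pi.single a 1)

theorem pd_eq_of_hasDerivAt {n : ℕ} {f : Cn n → ℂ} {y : Cn n} {a : Fin n} {c : ℂ}
    (hf : ContDiffAt ℂ ∞ f y)
    (h : HasDerivAt (fun t : ℂ => f (y + t • Pi.single a 1)) c 0) : pd a f y = c :=
  (hf.hasDerivAt_pd a).unique h

theorem pd_congr {n : ℕ} {f g : Cn n → ℂ} {y : Cn n} (h : f =ᶠ[𝓝 y] g) (a : Fin n) :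
    pd a f y = pd a g y := by
  rw [pd, pd, h.fderiv_eq]

theorem pd_const {n : ℕ} (c : ℂ) (y : Cn n) (a : Fin n) : pd a (fun _ => c) y = 0 := by
  simp [pd]

theorem pd_coord {n : ℕ} (y : Cn n) (a i : Fin n) :
    pd a (fun y => y i) y = if i = a then 1 else 0 := by
  have : HasFDerivAt (fun y : Cn n => y i) (ContinuousLinearMap.proj (R := ℂ) i) y :=
    (ContinuousLinearMap.proj (R := ℂ) (φ := fun _ : Fin n => ℂ) i).hasFDerivAt
  simp [pd, this.fderiv, Pi.single_apply]

theorem pd_add {n : ℕ} {f g : Cn n → ℂ} {y : Cn n} (hf : ContDiffAt ℂ ∞ f y)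
    (hg : ContDiffAt ℂ ∞ g y) (a : Fin n) :
    pd a (fun y => f y + g y) y = pd a f y + pd a g y := by
  rw [pd, fderiv_fun_add (hf.differentiableAt (by simp)) (hg.differentiableAt (by simp))]
  rfl

theorem pd_mul {n : ℕ} {f g : Cn n → ℂ} {y : Cn n} (hf : ContDiffAt ℂ ∞ f y)
    (hg : ContDiffAt ℂ ∞ g y) (a : Fin n) :
    pd a (fun y => f y * g y) y = pd a f y * g y + f y * pd a g y := by
  rw [pd, fderiv_fun_mul (hf.differentiableAt (by simp)) (hg.differentiableAt (by simp))]
  simp [pd]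
  ring

theorem pd_comp {n m : ℕ} {f : Cn m → ℂ} {g : Cn n → Cn m} {y : Cn n}
    (hf : ContDiffAt ℂ ∞ f (g y)) (hg : ContDiffAt ℂ ∞ g y) (a : Fin n) :
    pd a (fun y => f (g y)) y = ∑ i, pd i f (g y) * pd a (fun y => g y i) y := by
  have h := (hf.differentiableAt (by simp)).hasFDerivAt.comp y
    (hg.differentiableAt (by simp)).hasFDerivAt
  have h2 : ∀ i, pd a (fun y => g y i) y = fderiv ℂ g y (Pi.single a 1) i := fun i => by
    have := hasFDerivAt_pi'.1 (hg.differentiableAt (by simp)).hasFDerivAt i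
    rw [pd, this.fderiv]
    rfl
  have h3 : pd a (fun y => f (g y)) y = fderiv ℂ f (g y) (fderiv ℂ g y (Pi.single a 1)) := by
    rw [pd]
    exact congrArg (fun L => L (Pi.single a 1)) h.fderiv
  rw [h3, clm_apply_eq_sum]
  exact Finset.sum_congr rfl fun i _ => by rw [h2]; rfl

theorem pd_comm {n : ℕ} {f : Cn n → ℂ} {y : Cn n} (hf : ContDiffAt ℂ ∞ f y) (a b : Fin n) :
    pd a (pd b f) y = pd b (pd a f) y := by
  have h := hf.isSymmSndFDerivAt (by
    rw [minSmoothness_of_isRCLikeNormedField]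
    exact WithTop.coe_le_coe.2 (le_top (a := (2 : ℕ∞))))
  have hd : DifferentiableAt ℂ (fderiv ℂ f) y :=
    (hf.fderiv_right (m := ∞) (by simp)).differentiableAt (by simp)
  have key : ∀ a b : Fin n, pd a (pd b f) y =
      fderiv ℂ (fderiv ℂ f) y (Pi.single a 1) (Pi.single b 1) := by
    intro a b
    change fderiv ℂ (fun z => fderiv ℂ f z (Pi.single b 1)) y (Pi.single a 1) = _
    rw [fderiv_clm_apply hd (differentiableAt_const _)]
    simp
  rw [key, key, h]

theorem hasDerivAt_det {n : ℕ} {A : ℂ → Matrix (Fin n) (Fin n) ℂ} {A' : Matrix (Fin n) (Fin n) ℂ}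
    {t : ℂ} (h : ∀ i j, HasDerivAt (fun t => A t i j) (A' i j) t) :
    HasDerivAt (fun t => (A t).det) (∑ b, ((A t).updateCol b fun i => A' i b).det) t := by
  let D : ContinuousMultilinearMap ℂ (fun _ : Fin n => Fin n → ℂ) ℂ :=
    { toMultilinearMap := (Matrix.detRowAlternating (R := ℂ) (n := Fin n)).toMultilinearMap
      cont := by
        change Continuous fun M : Matrix (Fin n) (Fin n) ℂ => M.det
        exact continuous_id.matrix_det }
  have hD : ∀ M : Fin n → Fin n → ℂ, D M = (Matrix.of M).det := fun _ => rfl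
  have hA : HasDerivAt (fun t j i => A t i j) (fun j i => A' i j) t :=
    hasDerivAt_pi.2 fun j => hasDerivAt_pi.2 fun i => h i j
  have := (D.hasFDerivAt fun j i => A t i j).comp_hasDerivAt t hA
  have h1 : (fun t => (A t).det) = D ∘ fun t j i => A t i j := by
    funext t
    rw [Function.comp_apply, hD, ← Matrix.det_transpose]
    rfl
  rw [h1]
  refine this.congr_deriv ?_
  rw [ContinuousMultilinearMap.linearDeriv_apply]
  refine Finset.sum_congr rfl fun b _ => ?_
  rw [hD, ← Matrix.det_transpose (Matrix.updateCol _ _ _), ← Matrix.updateRow_transpose]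
  rfl

theorem contDiffAt_det {n m : ℕ} {M : Fin m → Fin m → Cn n → ℂ} {y : Cn n}
    (hM : ∀ i j, ContDiffAt ℂ ∞ (M i j) y) :
    ContDiffAt ℂ ∞ (fun y => (Matrix.of fun i j => M i j y).det) y := by
  simp only [Matrix.det_apply]
  refine ContDiffAt.sum fun σ _ => ?_
  refine ContDiffAt.const_smul _ (contDiffAt_prod fun i _ => hM _ _)

theorem pd_det {n m : ℕ} {M : Fin m → Fin m → Cn n → ℂ} {y : Cn n}
    (hM : ∀ i j, ContDiffAt ℂ ∞ (M i j) y) (a : Fin n) :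
    pd a (fun y => (Matrix.of fun i j => M i j y).det) y =
      ∑ b, ((Matrix.of fun i j => M i j y).updateCol b fun i => pd a (M i b) y).det := by
  refine pd_eq_of_hasDerivAt (contDiffAt_det hM) ?_
  have := hasDerivAt_det (t := 0) (A := fun t => Matrix.of fun i j =>
    M i j (y + t • Pi.single a 1)) (A' := fun i j => pd a (M i j) y)
    fun i j => (hM i j).hasDerivAt_pd a
  simpa using this

theorem det_updateCol_updateCol_swap {n : ℕ} (M : Matrix (Fin n) (Fin n) ℂ) (u w : Fin n → ℂ)
    {a b : Fin n} (hab : a ≠ b) :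
    ((M.updateCol b u).updateCol a w).det = -((M.updateCol a u).updateCol b w).det := by
  have h : (M.updateCol b u).updateCol a w =
      ((M.updateCol a u).updateCol b w).submatrix id (Equiv.swap a b) := by
    ext i j
    simp only [Matrix.updateCol_apply, Matrix.submatrix_apply, id]
    by_cases hja : j = a
    · subst hja; simp
    · by_cases hjb : j = b
      · subst hjb; simp [hja, hab]
      · simp [hja, hjb, Equiv.swap_apply_of_ne_of_ne hja hjb]
  rw [h, Matrix.det_permute', Equiv.Perm.sign_swap hab]
  simp

/-- The Jacobian matrix of a family of functions. -/
def jac {n m : ℕ} (P : Fin m → Cn n → ℂ) (y : Cn n) : Matrix (Fin m) (Fin n) ℂ :=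
  Matrix.of fun l a => pd a (P l) y

theorem contDiffAt_det_jac {n : ℕ} {P : Fin n → Cn n → ℂ} {y : Cn n}
    (hP : ∀ l, ContDiffAt ℂ ∞ (P l) y) : ContDiffAt ℂ ∞ (fun y => (jac P y).det) y :=
  contDiffAt_det fun l a => contDiffAt_pd (hP l) a

theorem cramer_jac_eq {n : ℕ} (P L : Fin n → Cn n → ℂ) (a : Fin n) (y : Cn n) :
    (jac P y).cramer (fun l => L l y) a =
      (Matrix.of fun l b => (if b = a then L l else pd b (P l)) y).det := by
  rw [Matrix.cramer_apply]
  congr 1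
  ext l b
  rw [Matrix.updateCol_apply]
  by_cases h : b = a <;> simp [h, jac]

theorem contDiffAt_cramer_jac {n : ℕ} {P L : Fin n → Cn n → ℂ} {y : Cn n}
    (hP : ∀ l, ContDiffAt ℂ ∞ (P l) y) (hL : ∀ l, ContDiffAt ℂ ∞ (L l) y) (a : Fin n) :
    ContDiffAt ℂ ∞ (fun y => (jac P y).cramer (fun l => L l y) a) y := by
  simp only [cramer_jac_eq]
  refine contDiffAt_det fun l b => ?_
  split_ifs
  exacts [hL l, contDiffAt_pd (hP l) b]

/-- The Piola identity. -/
theorem sum_pd_cramer_jac {n : ℕ} {P L : Fin n → Cn n → ℂ} {y : Cn n}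
    (hP : ∀ l, ContDiffAt ℂ ∞ (P l) y) (hL : ∀ l, ContDiffAt ℂ ∞ (L l) y) :
    ∑ a, pd a (fun y => (jac P y).cramer (fun l => L l y) a) y =
      ∑ a, ((jac P y).updateCol a fun l => pd a (L l) y).det := by
  have hM : ∀ a l b, ContDiffAt ℂ ∞ (if b = a then L l else pd b (P l)) y := by
    intro a l b
    split_ifs
    exacts [hL l, contDiffAt_pd (hP l) b]
  have hmat : ∀ a, (Matrix.of fun l b => (if b = a then L l else pd b (P l)) y) =
      (jac P y).updateCol a fun l => L l y := by
    intro a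
    ext l b
    rw [Matrix.updateCol_apply]
    by_cases h : b = a <;> simp [h, jac]
  set T : Fin n → Fin n → ℂ := fun a b =>
    if a = b then 0 else (((jac P y).updateCol a fun l => L l y).updateCol b
      fun l => pd a (pd b (P l)) y).det with hT
  have hterm : ∀ a, pd a (fun y => (jac P y).cramer (fun l => L l y) a) y =
      ((jac P y).updateCol a fun l => pd a (L l) y).det + ∑ b, T a b := by
    intro a
    simp only [cramer_jac_eq]
    rw [pd_det (hM a) a, hmat, Fintype.sum_eq_add_sum_compl a,
      Fintype.sum_eq_add_sum_compl a (T a)]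
    simp only [hT, if_true, zero_add]
    congr 1
    · congr 1
      ext l b
      simp only [Matrix.updateCol_apply]
      split_ifs <;> simp
    · refine Finset.sum_congr rfl fun b hb => ?_
      have hb' : b ≠ a := by simpa using hb
      rw [if_neg hb'.symm]
      refine congrArg (fun v => (Matrix.updateCol _ b v).det) ?_
      funext l
      rw [if_neg hb']
  have hanti : ∀ a b, T b a = -T a b := by
    intro a b
    by_cases hab : a = b
    · subst hab
      simp [hT]
    · simp only [hT]
      rw [if_neg hab, if_neg (Ne.symm hab), det_updateCol_updateCol_swap _ _ _ hab]
      simp only [pd_comm (hP _) b a]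
  have hzero : ∑ a, ∑ b, T a b = 0 := by
    have h1 : ∑ a, ∑ b, T a b = -∑ a, ∑ b, T a b := by
      conv_lhs => rw [Finset.sum_comm]
      rw [← Finset.sum_neg_distrib]
      refine Finset.sum_congr rfl fun b _ => ?_
      rw [← Finset.sum_neg_distrib]
      exact Finset.sum_congr rfl fun a _ => hanti b a
    linear_combination h1 / 2
  rw [Finset.sum_congr rfl fun a _ => hterm a, Finset.sum_add_distrib, hzero, add_zero]

/-- The family of functions `P + t L`. -/
def pencil {n : ℕ} (P L : Fin n → Cn n → ℂ) (t : ℝ) (l : Fin n) (y : Cn n) : ℂ :=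
  P l y + t * L l y

theorem contDiffAt_pencil {n : ℕ} {P L : Fin n → Cn n → ℂ} {y : Cn n} (t : ℝ)
    (hP : ∀ l, ContDiffAt ℂ ∞ (P l) y) (hL : ∀ l, ContDiffAt ℂ ∞ (L l) y) (l : Fin n) :
    ContDiffAt ℂ ∞ (pencil P L t l) y :=
  (hP l).add (contDiffAt_const.mul (hL l))

theorem pd_pencil {n : ℕ} {P L : Fin n → Cn n → ℂ} {y : Cn n} (t : ℝ)
    (hP : ∀ l, ContDiffAt ℂ ∞ (P l) y) (hL : ∀ l, ContDiffAt ℂ ∞ (L l) y) (l a : Fin n) :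
    pd a (pencil P L t l) y = pd a (P l) y + t * pd a (L l) y := by
  unfold pencil
  rw [pd_add (hP l) (contDiffAt_const.mul (hL l)), pd_mul contDiffAt_const (hL l), pd_const]
  ring

theorem hasDerivAt_degree_integral {n : ℕ} {r δ : ℝ} {P L : Fin n → Cn n → ℂ}
    (hP : ∀ l, ∀ y ∈ Metric.closedBall 0 r, ContDiffAt ℂ ∞ (P l) y)
    (hL : ∀ l, ∀ y ∈ Metric.closedBall 0 r, ContDiffAt ℂ ∞ (L l) y)
    {ρ : ℝ → ℝ} (hρ : ContDiff ℝ ∞ ρ) (hρδ : ∀ s, δ < s → ρ s = 0) (t : ℝ)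
    (hsph : ∀ y ∈ Metric.sphere 0 r, δ < nsq (pencil P L t) y) :
    HasDerivAt (fun t => ∫ y in Metric.ball (0 : Cn n) r,
      Complex.normSq (jac (pencil P L t) y).det * ρ (nsq (pencil P L t) y)) 0 t := by
  set B := Metric.closedBall (0 : Cn n) r
  have hB : IsCompact B := isCompact_closedBall _ _
  set M : ℝ → Cn n → Matrix (Fin n) (Fin n) ℂ :=
    fun s y => Matrix.of fun l a => pd a (P l) y + s * pd a (L l) y with hM
  have hjac : ∀ s, ∀ y ∈ B, jac (pencil P L s) y = M s y := by
    intro s y hy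
    ext l a
    exact pd_pencil s (fun l => hP l y hy) (fun l => hL l y hy) l a
  set J' : ℝ → Cn n → ℂ := fun s y => ∑ b, ((M s y).updateCol b fun l => pd b (L l) y).det with hJ'
  set F' : ℝ → Cn n → ℝ := fun s y =>
    2 * (conj (M s y).det * J' s y).re * ρ (nsq (pencil P L s) y) +
      Complex.normSq (M s y).det * (deriv ρ (nsq (pencil P L s) y) *
        ∑ l, 2 * (conj (pencil P L s l y) * L l y).re) with hF'
  have hPc := fun l => continuousOn_of_contDiffAt (hP l)
  have hLc := fun l => continuousOn_of_contDiffAt (hL l)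
  have hPd := fun l a => continuousOn_of_contDiffAt fun y hy => contDiffAt_pd (hP l y hy) a
  have hLd := fun l a => continuousOn_of_contDiffAt fun y hy => contDiffAt_pd (hL l y hy) a
  have hsnd : ∀ f : Cn n → ℂ, ContinuousOn f B →
      ContinuousOn (fun q : ℝ × Cn n => f q.2) (univ ×ˢ B) := fun f hf =>
    hf.comp continuousOn_snd fun q hq => hq.2
  have hof : ContinuousOn (fun q : ℝ × Cn n => (q.1 : ℂ)) (univ ×ˢ B) := by fun_prop
  have hpen : ∀ l, ContinuousOn (fun q : ℝ × Cn n => pencil P L q.1 l q.2) (univ ×ˢ B) :=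
    fun l => (hsnd _ (hPc l)).add (hof.mul (hsnd _ (hLc l)))
  have hMc : ∀ l a, ContinuousOn (fun q : ℝ × Cn n => M q.1 q.2 l a) (univ ×ˢ B) :=
    fun l a => (hsnd _ (hPd l a)).add (hof.mul (hsnd _ (hLd l a)))
  have hdetc : ∀ A : ℝ × Cn n → Matrix (Fin n) (Fin n) ℂ,
      (∀ i j, ContinuousOn (fun q => A q i j) (univ ×ˢ B)) →
      ContinuousOn (fun q => (A q).det) (univ ×ˢ B) := by
    intro A hA
    simp only [Matrix.det_apply]
    exact continuousOn_finsetSum _ fun σ _ => ContinuousOn.const_smul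
      (continuousOn_finsetProd _ fun i _ => hA _ _) _
  have hMdet := hdetc (fun q => M q.1 q.2) hMc
  have hJ'c : ContinuousOn (fun q : ℝ × Cn n => J' q.1 q.2) (univ ×ˢ B) := by
    refine continuousOn_finsetSum _ fun b _ => hdetc _ fun i j => ?_
    simp only [Matrix.updateCol_apply]
    split_ifs
    exacts [hsnd _ (hLd i b), hMc i j]
  have hnsqc : ContinuousOn (fun q : ℝ × Cn n => nsq (pencil P L q.1) q.2) (univ ×ˢ B) :=
    continuousOn_finsetSum _ fun l _ => Complex.continuous_normSq.comp_continuousOn (hpen l)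
  have hFc : ContinuousOn (fun q : ℝ × Cn n => Complex.normSq (M q.1 q.2).det *
      ρ (nsq (pencil P L q.1) q.2)) (univ ×ˢ B) :=
    (Complex.continuous_normSq.comp_continuousOn hMdet).mul
      (hρ.continuous.comp_continuousOn hnsqc)
  have hF'c : ContinuousOn (fun q : ℝ × Cn n => F' q.1 q.2) (univ ×ˢ B) := by
    refine ContinuousOn.add (ContinuousOn.mul (continuousOn_const.mul ?_) ?_)
      (ContinuousOn.mul ?_ (ContinuousOn.mul ?_ ?_))
    · exact Complex.continuous_re.comp_continuousOn
        ((Complex.continuous_conj.comp_continuousOn hMdet).mul hJ'c)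
    · exact hρ.continuous.comp_continuousOn hnsqc
    · exact Complex.continuous_normSq.comp_continuousOn hMdet
    · exact (hρ.continuous_deriv (by simp)).comp_continuousOn hnsqc
    · exact continuousOn_finsetSum _ fun l _ => continuousOn_const.mul
        (Complex.continuous_re.comp_continuousOn
          ((Complex.continuous_conj.comp_continuousOn (hpen l)).mul (hsnd _ (hLc l))))
  have hfix : ∀ (f : ℝ × Cn n → ℝ) (s : ℝ), ContinuousOn f (univ ×ˢ B) →
      IntegrableOn (fun y => f (s, y)) (Metric.ball 0 r) := fun f s hf =>
    ((hf.comp (f := fun y : Cn n => (s, y)) (by fun_prop)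
      fun y hy => ⟨mem_univ _, hy⟩).integrableOn_compact hB).mono_set Metric.ball_subset_closedBall
  obtain ⟨C, hC⟩ := (isCompact_Icc (a := t - 1) (b := t + 1)).prod hB
    |>.exists_bound_of_continuousOn (hF'c.mono (prod_mono (subset_univ _) subset_rfl))
  have hbB : ∀ y ∈ Metric.ball (0 : Cn n) r, y ∈ B := fun y hy => Metric.ball_subset_closedBall hy
  have hder : ∀ s, ∀ y ∈ B, HasDerivAt (fun s => Complex.normSq (M s y).det *
      ρ (nsq (pencil P L s) y)) (F' s y) s := by
    intro s y hy
    have h1 : HasDerivAt (fun s : ℝ => (M s y).det) (J' s y) s := by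
      have := hasDerivAt_det (t := (s : ℂ)) (A := fun s => Matrix.of fun l a =>
        pd a (P l) y + s * pd a (L l) y) (A' := fun l a => pd a (L l) y) fun l a => by
          simpa using ((hasDerivAt_id (s : ℂ)).mul_const (pd a (L l) y)).const_add (pd a (P l) y)
      exact this.comp_ofReal
    have h2 : ∀ l, HasDerivAt (fun s : ℝ => pencil P L s l y) (L l y) s := fun l => by
      have : HasDerivAt (fun s : ℂ => P l y + s * L l y) (L l y) (s : ℂ) := by
        simpa using ((hasDerivAt_id (s : ℂ)).mul_const (L l y)).const_add (P l y)
      exact this.comp_ofReal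
    have h3 := HasDerivAt.fun_sum (u := Finset.univ) fun l _ => (h2 l).normSq
    have h4 := (((hρ.differentiable (by simp)) (nsq (pencil P L s) y)).hasDerivAt).comp s h3
    exact h1.normSq.mul h4
  have hInt0 : ∫ y in Metric.ball (0 : Cn n) r, F' t y = 0 := by
    have hdiv := setIntegral_divergence_eq_zero (P := pencil P L t)
      (H := fun y => (jac (pencil P L t) y).det)
      (W := fun a y => (jac (pencil P L t) y).cramer (fun l => L l y) a) (r := r)
      (fun l y hy => contDiffAt_pencil t (fun l => hP l y hy) (fun l => hL l y hy) l)
      (fun y hy => contDiffAt_det_jac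
        (contDiffAt_pencil t (fun l => hP l y hy) (fun l => hL l y hy)))
      (fun a y hy => contDiffAt_cramer_jac
        (contDiffAt_pencil t (fun l => hP l y hy) (fun l => hL l y hy)) (fun l => hL l y hy) a)
      hsph hρ hρδ
    have hG : ∀ y ∈ Metric.ball (0 : Cn n) r, conj (jac (pencil P L t) y).det *
        ((∑ a, pd a (fun y => (jac (pencil P L t) y).cramer (fun l => L l y) a) y) *
          ρ (nsq (pencil P L t) y) + ((deriv ρ (nsq (pencil P L t) y) : ℝ) : ℂ) *
          ∑ l, conj (pencil P L t l y) * ∑ a, pd a (pencil P L t l) y *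
            (jac (pencil P L t) y).cramer (fun l => L l y) a) =
        conj (M t y).det * (J' t y * ρ (nsq (pencil P L t) y) +
          ((deriv ρ (nsq (pencil P L t) y) : ℝ) : ℂ) *
          ∑ l, conj (pencil P L t l y) * ((M t y).det * L l y)) := by
      intro y hy
      have hp := contDiffAt_pencil t (fun l => hP l y (hbB y hy)) (fun l => hL l y (hbB y hy))
      rw [sum_pd_cramer_jac hp fun l => hL l y (hbB y hy)]
      have hmul : ∀ l, ∑ a, pd a (pencil P L t l) y *
          (jac (pencil P L t) y).cramer (fun l => L l y) a = (M t y).det * L l y := by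
        intro l
        have := congrFun (Matrix.mulVec_cramer (jac (pencil P L t) y) fun l => L l y) l
        rw [hjac t y (hbB y hy)] at this ⊢
        rw [Pi.smul_apply, smul_eq_mul] at this
        rw [← this, ← hjac t y (hbB y hy)]
        rfl
      simp only [hmul]
      simp only [hjac t y (hbB y hy), hJ']
    rw [setIntegral_congr_fun measurableSet_ball hG] at hdiv
    have hGc : ContinuousOn (fun q : ℝ × Cn n => conj (M q.1 q.2).det *
        (J' q.1 q.2 * ρ (nsq (pencil P L q.1) q.2) +
          ((deriv ρ (nsq (pencil P L q.1) q.2) : ℝ) : ℂ) *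
          ∑ l, conj (pencil P L q.1 l q.2) * ((M q.1 q.2).det * L l q.2))) (univ ×ˢ B) := by
      refine (Complex.continuous_conj.comp_continuousOn hMdet).mul
        ((hJ'c.mul (Complex.continuous_ofReal.comp_continuousOn
          (hρ.continuous.comp_continuousOn hnsqc))).add
        ((Complex.continuous_ofReal.comp_continuousOn
          ((hρ.continuous_deriv (by simp)).comp_continuousOn hnsqc)).mul ?_))
      exact continuousOn_finsetSum _ fun l _ =>
        (Complex.continuous_conj.comp_continuousOn (hpen l)).mul (hMdet.mul (hsnd _ (hLc l)))
    have hGint : IntegrableOn (fun y => conj (M t y).det *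
        (J' t y * ρ (nsq (pencil P L t) y) +
          ((deriv ρ (nsq (pencil P L t) y) : ℝ) : ℂ) *
          ∑ l, conj (pencil P L t l y) * ((M t y).det * L l y))) (Metric.ball 0 r) :=
      ((hGc.comp (f := fun y : Cn n => (t, y)) (by fun_prop)
        fun y hy => ⟨mem_univ _, hy⟩).integrableOn_compact hB).mono_set
        Metric.ball_subset_closedBall
    have hre := congrArg Complex.re hdiv
    rw [← Complex.reCLM_apply, ← ContinuousLinearMap.integral_comp_comm _ hGint,
      Complex.zero_re] at hre
    have : ∀ y, F' t y = 2 * Complex.reCLM (conj (M t y).det *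
        (J' t y * ρ (nsq (pencil P L t) y) +
          ((deriv ρ (nsq (pencil P L t) y) : ℝ) : ℂ) *
          ∑ l, conj (pencil P L t l y) * ((M t y).det * L l y))) := by
      intro y
      have h1 : ∑ l, conj (pencil P L t l y) * ((M t y).det * L l y) =
          (M t y).det * ∑ l, conj (pencil P L t l y) * L l y := by
        rw [Finset.mul_sum]
        exact Finset.sum_congr rfl fun l _ => by ring
      have h2 : conj (M t y).det * (J' t y * ρ (nsq (pencil P L t) y) +
          ((deriv ρ (nsq (pencil P L t) y) : ℝ) : ℂ) * ((M t y).det *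
            ∑ l, conj (pencil P L t l y) * L l y)) =
          (ρ (nsq (pencil P L t) y) : ℝ) * (conj (M t y).det * J' t y) +
          ((Complex.normSq (M t y).det * deriv ρ (nsq (pencil P L t) y) : ℝ) : ℂ) *
            ∑ l, conj (pencil P L t l y) * L l y := by
        rw [Complex.ofReal_mul, Complex.normSq_eq_conj_mul_self]
        ring
      rw [Complex.reCLM_apply, h1, h2, Complex.add_re, Complex.re_ofReal_mul,
        Complex.re_ofReal_mul, Complex.re_sum, hF']
      simp only [← Finset.mul_sum]
      ring
    simp only [this]
    rw [integral_const_mul, hre, mul_zero]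
  have hcongr : (fun t => ∫ y in Metric.ball (0 : Cn n) r,
      Complex.normSq (jac (pencil P L t) y).det * ρ (nsq (pencil P L t) y)) =
      fun t => ∫ y in Metric.ball (0 : Cn n) r,
      Complex.normSq (M t y).det * ρ (nsq (pencil P L t) y) := by
    funext s
    refine setIntegral_congr_fun measurableSet_ball fun y hy => ?_
    simp only [hjac s y (hbB y hy)]
  rw [hcongr, ← hInt0]
  refine (hasDerivAt_integral_of_dominated_loc_of_deriv_le (bound := fun _ => C)
    (Icc_mem_nhds (a := t - 1) (b := t + 1) (by linarith) (by linarith)) ?_ ?_ ?_ ?_ ?_ ?_).2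
  · exact .of_forall fun s => (hfix _ s hFc).aestronglyMeasurable
  · exact hfix _ t hFc
  · exact (hfix _ t hF'c).aestronglyMeasurable
  · exact (ae_restrict_iff' measurableSet_ball).2 (.of_forall fun y hy s hs =>
      hC (s, y) ⟨hs, hbB y hy⟩)
  · exact integrableOn_const (measure_ball_lt_top.ne)
  · exact (ae_restrict_iff' measurableSet_ball).2 (.of_forall fun y hy s hs =>
      hder s y (hbB y hy))

theorem degree_integral_eq {n : ℕ} {r δ : ℝ} {P L : Fin n → Cn n → ℂ}
    (hP : ∀ l, ∀ y ∈ Metric.closedBall 0 r, ContDiffAt ℂ ∞ (P l) y)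
    (hL : ∀ l, ∀ y ∈ Metric.closedBall 0 r, ContDiffAt ℂ ∞ (L l) y)
    {ρ : ℝ → ℝ} (hρ : ContDiff ℝ ∞ ρ) (hρδ : ∀ s, δ < s → ρ s = 0)
    {T : ℝ} (hT : 0 ≤ T)
    (hsph : ∀ t ∈ Icc 0 T, ∀ y ∈ Metric.sphere 0 r, δ < nsq (pencil P L t) y) :
    ∫ y in Metric.ball (0 : Cn n) r, Complex.normSq (jac P y).det * ρ (nsq P y) =
      ∫ y in Metric.ball (0 : Cn n) r,
        Complex.normSq (jac (pencil P L T) y).det * ρ (nsq (pencil P L T) y) := by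
  have h0 : pencil P L 0 = P := by
    funext l y
    simp [pencil]
  have h := fun t ht => hasDerivAt_degree_integral hP hL hρ hρδ t (hsph t ht)
  have := constant_of_has_deriv_right_zero (a := 0) (b := T)
    (fun t ht => (h t ht).continuousAt.continuousWithinAt)
    (fun t ht => (h t ⟨ht.1, ht.2.le⟩).hasDerivWithinAt) T ⟨hT, le_rfl⟩
  simpa [h0] using this.symm

/-- A smooth nonnegative function on the line which is positive exactly on `(-∞, δ)`. -/
def bump (δ s : ℝ) : ℝ := expNegInvGlue (δ - s)

theorem contDiff_bump (δ : ℝ) : ContDiff ℝ ∞ (bump δ) :=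
  expNegInvGlue.contDiff.comp (contDiff_const.sub contDiff_id)

theorem bump_eq_zero {δ s : ℝ} (h : δ < s) : bump δ s = 0 :=
  expNegInvGlue.zero_of_nonpos (by linarith)

theorem bump_nonneg (δ s : ℝ) : 0 ≤ bump δ s := expNegInvGlue.nonneg _

theorem bump_pos {δ s : ℝ} (h : s < δ) : 0 < bump δ s :=
  expNegInvGlue.pos_of_pos (by linarith)

theorem exists_pos_forall_lt_of_isCompact {α : Type*} [TopologicalSpace α] {K : Set α}
    (hK : IsCompact K) {f : α → ℝ} (hf : ContinuousOn f K) (h : ∀ x ∈ K, 0 < f x) :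
    ∃ δ > 0, ∀ x ∈ K, δ < f x := by
  rcases K.eq_empty_or_nonempty with rfl | hne
  · exact ⟨1, one_pos, by simp⟩
  · obtain ⟨x, hx, hmin⟩ := hK.exists_isMinOn hne hf
    exact ⟨f x / 2, half_pos (h x hx), fun y hy => (half_lt_self (h x hx)).trans_le (hmin hy)⟩

theorem nsq_nonneg {n m : ℕ} (P : Fin m → Cn n → ℂ) (y : Cn n) : 0 ≤ nsq P y :=
  Finset.sum_nonneg fun _ _ => Complex.normSq_nonneg _

theorem nsq_eq_zero {n m : ℕ} {P : Fin m → Cn n → ℂ} {y : Cn n} :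
    nsq P y = 0 ↔ ∀ l, P l y = 0 := by
  rw [nsq, Finset.sum_eq_zero_iff_of_nonneg fun _ _ => Complex.normSq_nonneg _]
  simp

theorem nsq_pos {n m : ℕ} {P : Fin m → Cn n → ℂ} {y : Cn n} (h : ∃ l, P l y ≠ 0) :
    0 < nsq P y := by
  refine (nsq_nonneg P y).lt_of_ne fun h0 => ?_
  obtain ⟨l, hl⟩ := h
  exact hl (nsq_eq_zero.1 h0.symm l)

theorem frequently_det_add_smul_ne_zero {n : ℕ} (A : Matrix (Fin n) (Fin n) ℂ) :
    ∃ᶠ t : ℝ in 𝓝[>] 0, (A + (t : ℂ) • (1 : Matrix (Fin n) (Fin n) ℂ)).det ≠ 0 := by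
  have hfin : {t : ℝ | (A + (t : ℂ) • (1 : Matrix (Fin n) (Fin n) ℂ)).det = 0}.Finite := by
    refine ((((-A).charpoly.roots.toFinset).finite_toSet).preimage
      Complex.ofReal_injective.injOn).subset fun t ht => ?_
    have h1 : ((-A).charpoly).eval (t : ℂ) = 0 := by
      rw [Matrix.eval_charpoly, sub_neg_eq_add, add_comm, ← ht, Matrix.scalar_apply,
        ← Matrix.smul_one_eq_diagonal]
    simp only [mem_preimage, Finset.mem_coe, Multiset.mem_toFinset]
    exact (Polynomial.mem_roots (Matrix.charpoly_monic _).ne_zero).2 h1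
  intro h
  have h2 : ∀ᶠ t : ℝ in 𝓝[>] (0 : ℝ),
      t ∉ {t : ℝ | (A + (t : ℂ) • (1 : Matrix (Fin n) (Fin n) ℂ)).det = 0} \ {0} :=
    nhdsWithin_le_nhds ((hfin.subset sdiff_subset).isClosed.isOpen_compl.mem_nhds (by simp))
  have h3 : ∀ᶠ t : ℝ in 𝓝[>] (0 : ℝ), False := by
    filter_upwards [h, h2, self_mem_nhdsWithin] with t ht ht2 ht3
    exact ht2 ⟨not_not.1 ht, (ne_of_gt ht3 : t ≠ 0)⟩
  exact (NeBot.ne inferInstance) (Filter.eventually_false_iff_eq_bot.1 h3)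

theorem degree_integral_pos {n : ℕ} {r δ : ℝ} {P : Fin n → Cn n → ℂ} (hr : 0 < r) (hδ : 0 < δ)
    (hP : ∀ l, ∀ y ∈ Metric.closedBall 0 r, ContDiffAt ℂ ∞ (P l) y)
    (hP0 : ∀ l, P l 0 = 0) (hsph : ∀ y ∈ Metric.sphere 0 r, δ < nsq P y) :
    0 < ∫ y in Metric.ball (0 : Cn n) r, Complex.normSq (jac P y).det * bump δ (nsq P y) := by
  set L : Fin n → Cn n → ℂ := fun l y => y l
  have hL : ∀ l y, ContDiffAt ℂ ∞ (L l) y := fun l y => contDiffAt_pi.1 contDiffAt_id l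
  have h1 : ∀ᶠ t : ℝ in 𝓝 0, ∀ y ∈ Metric.sphere (0 : Cn n) r, δ < nsq (pencil P L t) y := by
    refine (isCompact_sphere (0 : Cn n) r).eventually_forall_of_forall_eventually fun y hy => ?_
    have hyB := Metric.sphere_subset_closedBall hy
    have hc : ContinuousAt (fun q : ℝ × Cn n => nsq (pencil P L q.1) q.2) (0, y) := by
      refine tendsto_finsetSum _ fun l _ => Complex.continuous_normSq.continuousAt.comp ?_
      refine ContinuousAt.add ?_ (Continuous.continuousAt (by fun_prop))
      exact ContinuousAt.comp (f := fun q : ℝ × Cn n => q.2) (hP l y hyB).continuousAt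
        continuousAt_snd
    refine hc.eventually (lt_mem_nhds ?_)
    simpa [pencil, nsq] using hsph y hy
  obtain ⟨ε, hε, hT0⟩ := Metric.nhds_basis_closedBall.eventually_iff.1 h1
  obtain ⟨T, hTdet, hT, hTε⟩ := ((frequently_det_add_smul_ne_zero (jac P 0)).and_eventually
    (Ioc_mem_nhdsGT hε)).exists
  have hhol := fun l y hy => contDiffAt_pencil T (fun l => hP l y hy) (fun l => hL l y) l
  rw [degree_integral_eq hP (fun l y _ => hL l y) (contDiff_bump δ) (fun s => bump_eq_zero) hT.le
    fun t ht => hT0 (by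
      rw [Metric.mem_closedBall, dist_zero_right, Real.norm_of_nonneg ht.1]
      exact ht.2.trans hTε)]
  set Q := pencil P L T
  have hcont : ContinuousOn (fun y => Complex.normSq (jac Q y).det * bump δ (nsq Q y))
      (Metric.closedBall 0 r) := by
    refine ContinuousOn.mul ?_ ?_
    · exact Complex.continuous_normSq.comp_continuousOn
        (continuousOn_of_contDiffAt fun y hy => contDiffAt_det_jac fun l => hhol l y hy)
    · exact (contDiff_bump δ).continuous.comp_continuousOn
        (continuousOn_nsq fun l => continuousOn_of_contDiffAt (hhol l))
  have hpos : 0 < Complex.normSq (jac Q 0).det * bump δ (nsq Q 0) := by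
    have h0 : (0 : Cn n) ∈ Metric.closedBall 0 r := Metric.mem_closedBall_self hr.le
    have hjac : jac Q 0 = jac P 0 + (T : ℂ) • (1 : Matrix (Fin n) (Fin n) ℂ) := by
      ext l a
      have := pd_pencil T (fun l => hP l 0 h0) (fun l => hL l 0) l a
      rw [pd_coord] at this
      simpa [jac, Matrix.one_apply] using this
    refine mul_pos (Complex.normSq_pos.2 (hjac ▸ hTdet)) (bump_pos ?_)
    rwa [nsq_eq_zero.2 fun l => by simp [Q, L, pencil, hP0 l]]
  rw [setIntegral_pos_iff_support_of_nonneg_ae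
    (.of_forall fun y => mul_nonneg (Complex.normSq_nonneg _) (bump_nonneg _ _))
    ((hcont.integrableOn_compact (isCompact_closedBall _ _)).mono_set
      Metric.ball_subset_closedBall)]
  have hev : ∀ᶠ y in 𝓝 (0 : Cn n), 0 < Complex.normSq (jac Q y).det * bump δ (nsq Q y) :=
    (hcont.continuousAt (Metric.closedBall_mem_nhds _ hr)).eventually (lt_mem_nhds hpos)
  obtain ⟨U, hU, hUo, hU0⟩ := eventually_nhds_iff.1 hev
  refine ((hUo.inter Metric.isOpen_ball).measure_pos volume
    ⟨0, hU0, Metric.mem_ball_self hr⟩).trans_le (measure_mono fun y hy => ⟨?_, hy.2⟩)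
  exact (hU y hy.1).ne'

theorem eventually_exists_eq_of_isolated_zero {n : ℕ} {g : Cn n → Cn n} (hg : ContDiffAt ℂ ∞ g 0)
    (hg0 : g 0 = 0) (hiso : ∀ᶠ y in 𝓝 0, g y = 0 → y = 0) {N : Set (Cn n)} (hN : N ∈ 𝓝 0) :
    ∀ᶠ z in 𝓝 0, ∃ y ∈ N, g y = z := by
  obtain ⟨r, hr, hrN⟩ := Metric.nhds_basis_closedBall.eventually_iff.1
    (hg.eventually_infty_pi.and (hiso.and hN))
  set G : Fin n → Cn n → ℂ := fun l y => g y l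
  have hG : ∀ l, ∀ y ∈ Metric.closedBall 0 r, ContDiffAt ℂ ∞ (G l) y :=
    fun l y hy => contDiffAt_pi.1 (hrN hy).1 l
  obtain ⟨δ, hδ, hsph⟩ := exists_pos_forall_lt_of_isCompact (isCompact_sphere (0 : Cn n) r)
    ((continuousOn_nsq fun l => continuousOn_of_contDiffAt (hG l)).mono
      Metric.sphere_subset_closedBall) (fun y hy => nsq_pos (by
        by_contra! h
        have h0 := (hrN (Metric.sphere_subset_closedBall hy)).2.1 (funext h)
        rw [h0] at hy
        simp [hr.ne] at hy))
  have hclose : ∀ᶠ z in 𝓝 (0 : Cn n), ∀ q ∈ Icc (0 : ℝ) 1 ×ˢ Metric.sphere (0 : Cn n) r,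
      δ < nsq (pencil G (fun l _ => -z l) q.1) q.2 := by
    refine (isCompact_Icc.prod (isCompact_sphere (0 : Cn n) r)
      ).eventually_forall_of_forall_eventually fun q hq => ?_
    have hc : ContinuousAt (fun p : Cn n × (ℝ × Cn n) =>
        nsq (pencil G (fun l _ => -p.1 l) p.2.1) p.2.2) (0, q) := by
      refine tendsto_finsetSum _ fun l _ => Complex.continuous_normSq.continuousAt.comp ?_
      refine ContinuousAt.add ?_ (Continuous.continuousAt (by fun_prop))
      exact ContinuousAt.comp (f := fun p : Cn n × (ℝ × Cn n) => p.2.2) (x := (0, q))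
        (hG l q.2 (Metric.sphere_subset_closedBall hq.2)).continuousAt (by fun_prop)
    refine hc.eventually (lt_mem_nhds ?_)
    simpa [pencil, nsq, G] using hsph q.2 hq.2
  filter_upwards [hclose] with z hz
  by_contra! hne
  have hpen : ∀ y, ∀ l, pencil G (fun l _ => -z l) 1 l y = g y l - z l := by
    intro y l
    simp [pencil, G, sub_eq_add_neg]
  have hhol : ∀ l, ∀ y ∈ Metric.closedBall 0 r,
      ContDiffAt ℂ ∞ (pencil G (fun l _ => -z l) 1 l) y := fun l y hy =>
    contDiffAt_pencil 1 (fun l => hG l y hy) (fun _ => contDiffAt_const) l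
  obtain ⟨η, hη, hηlt⟩ := exists_pos_forall_lt_of_isCompact (isCompact_closedBall (0 : Cn n) r)
    (continuousOn_nsq fun l => continuousOn_of_contDiffAt (hhol l)) (fun y hy => nsq_pos (by
        by_contra! h
        exact hne y (hrN hy).2.2 (funext fun l => sub_eq_zero.1 ((hpen y l).symm.trans (h l)))))
  have hmin : 0 < min δ η := lt_min hδ hη
  have hpos := degree_integral_pos hr hmin hG (fun l => by simp [G, hg0])
    fun y hy => (min_le_left _ _).trans_lt (hsph y hy)
  rw [degree_integral_eq hG (L := fun l _ => -z l) (fun l y _ => contDiffAt_const)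
    (contDiff_bump _) (fun s => bump_eq_zero) zero_le_one
    fun t ht y hy => (min_le_left _ _).trans_lt (hz (t, y) ⟨ht, hy⟩),
    setIntegral_congr_fun (g := fun _ => (0 : ℝ)) measurableSet_ball fun y hy => ?_] at hpos
  · simp at hpos
  · simp only
    rw [bump_eq_zero ((min_le_right _ _).trans_lt (hηlt y (Metric.ball_subset_closedBall hy))),
      mul_zero]

theorem sum_pd_mul_cramer_jac_single {n : ℕ} (P : Fin n → Cn n → ℂ) (y : Cn n) (i l : Fin n) :
    ∑ a, pd a (P l) y * (jac P y).cramer (Pi.single i 1) a =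
      if l = i then (jac P y).det else 0 := by
  have := congrFun (Matrix.mulVec_cramer (jac P y) (Pi.single i 1)) l
  rw [Pi.smul_apply, smul_eq_mul, Pi.single_apply, mul_ite, mul_one, mul_zero] at this
  exact this

theorem contDiffAt_cramer_jac_single {n : ℕ} {P : Fin n → Cn n → ℂ} {y : Cn n}
    (hP : ∀ l, ContDiffAt ℂ ∞ (P l) y) (i a : Fin n) :
    ContDiffAt ℂ ∞ (fun y => (jac P y).cramer (Pi.single i 1) a) y :=
  contDiffAt_cramer_jac (L := fun l _ => (Pi.single i 1 : Fin n → ℂ) l) hP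
    (fun _ => contDiffAt_const) a

theorem sum_pd_cramer_jac_single {n : ℕ} {P : Fin n → Cn n → ℂ} {y : Cn n}
    (hP : ∀ l, ContDiffAt ℂ ∞ (P l) y) (i : Fin n) :
    ∑ a, pd a (fun y => (jac P y).cramer (Pi.single i 1) a) y = 0 := by
  have := sum_pd_cramer_jac (L := fun l _ => (Pi.single i 1 : Fin n → ℂ) l) hP
    (fun _ => contDiffAt_const)
  rw [this]
  refine Finset.sum_eq_zero fun a _ => Matrix.det_eq_zero_of_column_eq_zero a fun l => ?_
  simp [pd_const]

theorem setIntegral_mul_pullback_eq_zero {n : ℕ} {r δ : ℝ} {P : Fin n → Cn n → ℂ}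
    {H F : Cn n → ℂ}
    (hP : ∀ l, ∀ y ∈ Metric.closedBall 0 r, ContDiffAt ℂ ∞ (P l) y)
    (hH : ∀ y ∈ Metric.closedBall 0 r, ContDiffAt ℂ ∞ H y)
    (hF : ∀ y ∈ Metric.closedBall 0 r, ContDiffAt ℂ ∞ F y)
    (hPδ : ∀ y ∈ Metric.sphere 0 r, δ < nsq P y)
    {ρ : ℝ → ℝ} (hρ : ContDiff ℝ ∞ ρ) (hρδ : ∀ s, δ < s → ρ s = 0) (i : Fin n) :
    ∫ y in Metric.ball (0 : Cn n) r, conj (H y) *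
      ((∑ a, pd a F y * (jac P y).cramer (Pi.single i 1) a) * ρ (nsq P y) +
      ((deriv ρ (nsq P y) : ℝ) : ℂ) * (conj (P i y) * ((jac P y).det * F y))) = 0 := by
  rw [← setIntegral_divergence_eq_zero (W := fun a y => (jac P y).cramer (Pi.single i 1) a * F y)
    hP hH (fun a y hy => (contDiffAt_cramer_jac_single (fun l => hP l y hy) i a).mul (hF y hy))
    hPδ hρ hρδ]
  refine setIntegral_congr_fun measurableSet_ball fun y hy => ?_
  have hy := Metric.ball_subset_closedBall hy
  have hP' := fun l => hP l y hy
  have h1 : ∑ a, pd a (fun y => (jac P y).cramer (Pi.single i 1) a * F y) y =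
      ∑ a, pd a F y * (jac P y).cramer (Pi.single i 1) a := by
    simp only [pd_mul (contDiffAt_cramer_jac_single hP' i _) (hF y hy), Finset.sum_add_distrib]
    rw [← Finset.sum_mul, sum_pd_cramer_jac_single hP', zero_mul, zero_add]
    exact Finset.sum_congr rfl fun _ _ => mul_comm _ _
  have h2 : ∑ l, conj (P l y) * ∑ a, pd a (P l) y * ((jac P y).cramer (Pi.single i 1) a * F y) =
      conj (P i y) * ((jac P y).det * F y) := by
    simp only [← mul_assoc, ← Finset.sum_mul]
    congr 1
    simp only [sum_pd_mul_cramer_jac_single]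
    simp
  simp only [h1, h2]

section

variable {n : ℕ} {r δ : ℝ} {P v : Fin n → Cn n → ℂ} {H : Cn n → ℂ} {ρ : ℝ → ℝ}

theorem setIntegral_sum_eq {m : ℕ} {φ : Fin m → Cn n → ℂ}
    (hφ : ∀ i, ContinuousOn (φ i) (Metric.closedBall 0 r)) :
    ∫ y in Metric.ball (0 : Cn n) r, ∑ i, φ i y = ∑ i, ∫ y in Metric.ball (0 : Cn n) r, φ i y :=
  integral_finsetSum _ fun i _ => ((hφ i).integrableOn_compact
    (isCompact_closedBall _ _)).mono_set Metric.ball_subset_closedBall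

theorem setIntegral_tangent_pullback_eq_zero {F : Cn n → ℂ}
    (hP : ∀ l, ∀ y ∈ Metric.closedBall 0 r, ContDiffAt ℂ ∞ (P l) y)
    (hH : ∀ y ∈ Metric.closedBall 0 r, ContDiffAt ℂ ∞ H y)
    (hv : ∀ l, ∀ y ∈ Metric.closedBall 0 r, ContDiffAt ℂ ∞ (v l) y)
    (hF : ∀ y ∈ Metric.closedBall 0 r, ContDiffAt ℂ ∞ F y)
    (hPv : ∀ y ∈ Metric.closedBall 0 r, ∑ l, P l y * v l y = 0)
    (hPδ : ∀ y ∈ Metric.sphere 0 r, δ < nsq P y)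
    (hρ : ContDiff ℝ ∞ ρ) (hρδ : ∀ s, δ < s → ρ s = 0) :
    ∫ y in Metric.ball (0 : Cn n) r, conj (H y) * (∑ i, conj (v i y) *
      ∑ a, pd a F y * (jac P y).cramer (Pi.single i 1) a) * ρ (nsq P y) = 0 := by
  have hnsq : ContinuousOn (nsq P) (Metric.closedBall 0 r) :=
    continuousOn_nsq fun l => continuousOn_of_contDiffAt (hP l)
  have hsum : ∑ i, ∫ y in Metric.ball (0 : Cn n) r, conj (H y * v i y) *
      ((∑ a, pd a F y * (jac P y).cramer (Pi.single i 1) a) * ρ (nsq P y) +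
      ((deriv ρ (nsq P y) : ℝ) : ℂ) * (conj (P i y) * ((jac P y).det * F y))) = 0 :=
    Finset.sum_eq_zero fun i _ => setIntegral_mul_pullback_eq_zero hP
      (fun y hy => (hH y hy).mul (hv i y hy)) hF hPδ hρ hρδ i
  rw [← setIntegral_sum_eq] at hsum
  · rw [← hsum]
    refine setIntegral_congr_fun measurableSet_ball fun y hy => ?_
    have h0 : ∑ i, conj (v i y) * conj (P i y) = 0 := by
      have := congrArg conj (hPv y (Metric.ball_subset_closedBall hy))
      simpa [map_sum, mul_comm] using this
    have h1 : ∀ i, conj (H y * v i y) *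
        ((∑ a, pd a F y * (jac P y).cramer (Pi.single i 1) a) * ρ (nsq P y) +
        ((deriv ρ (nsq P y) : ℝ) : ℂ) * (conj (P i y) * ((jac P y).det * F y))) =
        conj (H y) * (conj (v i y) * ∑ a, pd a F y * (jac P y).cramer (Pi.single i 1) a) *
          ρ (nsq P y) + conj (H y) * ((deriv ρ (nsq P y) : ℝ) : ℂ) * ((jac P y).det * F y) *
          (conj (v i y) * conj (P i y)) := fun i => by
      rw [map_mul]
      ring
    simp only [h1]
    rw [Finset.sum_add_distrib, ← Finset.mul_sum, h0, mul_zero, add_zero, ← Finset.sum_mul,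
      ← Finset.mul_sum]
  · intro i
    refine (Complex.continuous_conj.comp_continuousOn (continuousOn_of_contDiffAt fun y hy =>
      (hH y hy).mul (hv i y hy))).mul (ContinuousOn.add (ContinuousOn.mul ?_ ?_)
        (ContinuousOn.mul ?_ (ContinuousOn.mul ?_ ?_)))
    · exact continuousOn_of_contDiffAt fun y hy => ContDiffAt.sum fun a _ =>
        (contDiffAt_pd (hF y hy) a).mul (contDiffAt_cramer_jac_single (fun l => hP l y hy) i a)
    · exact Complex.continuous_ofReal.comp_continuousOn (hρ.continuous.comp_continuousOn hnsq)
    · exact Complex.continuous_ofReal.comp_continuousOn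
        ((hρ.continuous_deriv (by simp)).comp_continuousOn hnsq)
    · exact Complex.continuous_conj.comp_continuousOn (continuousOn_of_contDiffAt (hP i))
    · exact continuousOn_of_contDiffAt fun y hy =>
        (contDiffAt_det_jac fun l => hP l y hy).mul (hF y hy)

theorem setIntegral_tangent_eq_zero
    (hP : ∀ l, ∀ y ∈ Metric.closedBall 0 r, ContDiffAt ℂ ∞ (P l) y)
    (hH : ∀ y ∈ Metric.closedBall 0 r, ContDiffAt ℂ ∞ H y)
    (hv : ∀ l, ∀ y ∈ Metric.closedBall 0 r, ContDiffAt ℂ ∞ (v l) y)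
    (hPv : ∀ y ∈ Metric.closedBall 0 r, ∑ l, P l y * v l y = 0)
    (hPδ : ∀ y ∈ Metric.sphere 0 r, δ < nsq P y)
    (hρ : ContDiff ℝ ∞ ρ) (hρδ : ∀ s, δ < s → ρ s = 0) (j : Fin n) :
    ∫ y in Metric.ball (0 : Cn n) r, conj (jac P y).det * (H y * v j y * ρ (nsq P y)) = 0 := by
  have h := congrArg conj (setIntegral_tangent_pullback_eq_zero hP hH hv (hP j) hPv hPδ hρ hρδ)
  rw [← integral_conj, map_zero] at h
  rw [← h]
  refine setIntegral_congr_fun measurableSet_ball fun y _ => ?_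
  simp only [sum_pd_mul_cramer_jac_single]
  simp
  ring

theorem setIntegral_tangent_symm_eq_zero
    (hP : ∀ l, ∀ y ∈ Metric.closedBall 0 r, ContDiffAt ℂ ∞ (P l) y)
    (hH : ∀ y ∈ Metric.closedBall 0 r, ContDiffAt ℂ ∞ H y)
    (hv : ∀ l, ∀ y ∈ Metric.closedBall 0 r, ContDiffAt ℂ ∞ (v l) y)
    (hPv : ∀ y ∈ Metric.closedBall 0 r, ∑ l, P l y * v l y = 0)
    (hPδ : ∀ y ∈ Metric.sphere 0 r, δ < nsq P y)
    (hρ : ContDiff ℝ ∞ ρ) (hρδ : ∀ s, δ < s → ρ s = 0) (j l : Fin n) :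
    ∫ y in Metric.ball (0 : Cn n) r, conj (jac P y).det *
      (H y * (v j y * conj (P l y) + v l y * conj (P j y)) * ρ (nsq P y)) = 0 := by
  have h := congrArg conj (setIntegral_tangent_pullback_eq_zero (F := fun y => P j y * P l y)
    hP hH hv (fun y hy => (hP j y hy).mul (hP l y hy)) hPv hPδ hρ hρδ)
  rw [← integral_conj, map_zero] at h
  rw [← h]
  refine setIntegral_congr_fun measurableSet_ball fun y hy => ?_
  have hy := Metric.ball_subset_closedBall hy
  have h1 : ∀ i, ∑ a, pd a (fun y => P j y * P l y) y * (jac P y).cramer (Pi.single i 1) a =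
      (if j = i then (jac P y).det else 0) * P l y + P j y *
        (if l = i then (jac P y).det else 0) := fun i => by
    simp only [pd_mul (hP j y hy) (hP l y hy), add_mul, Finset.sum_add_distrib]
    rw [← sum_pd_mul_cramer_jac_single, ← sum_pd_mul_cramer_jac_single, Finset.sum_mul,
      Finset.mul_sum]
    congr 1 <;> exact Finset.sum_congr rfl fun _ _ => by ring
  simp only [h1, mul_add, Finset.sum_add_distrib]
  simp
  ring

end

/-- If `P` has Jacobian matrix `S · jac G` with `S` symmetric, and is annihilated by the
`j`-th partial derivative of `G`, then its degree integral vanishes. -/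
theorem degree_integral_eq_zero {n : ℕ} {r δ : ℝ} {P G K : Fin n → Cn n → ℂ}
    {S : Fin n → Fin n → Cn n → ℂ} {c : Cn n → ℂ} {ρ : ℝ → ℝ} (j : Fin n)
    (hP : ∀ l, ∀ y ∈ Metric.closedBall 0 r, ContDiffAt ℂ ∞ (P l) y)
    (hG : ∀ l, ∀ y ∈ Metric.closedBall 0 r, ContDiffAt ℂ ∞ (G l) y)
    (hK : ∀ l, ∀ y ∈ Metric.closedBall 0 r, ContDiffAt ℂ ∞ (K l) y)
    (hS : ∀ l m, ∀ y ∈ Metric.closedBall 0 r, ContDiffAt ℂ ∞ (S l m) y)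
    (hc : ∀ y ∈ Metric.closedBall 0 r, ContDiffAt ℂ ∞ c y)
    (hsymm : ∀ l m, ∀ y ∈ Metric.closedBall 0 r, S l m y = S m l y)
    (hPG : ∀ l a, ∀ y ∈ Metric.closedBall 0 r,
      pd a (P l) y = ∑ m, S l m y * pd a (G m) y)
    (hann : ∀ y ∈ Metric.closedBall 0 r, ∑ l, P l y * pd j (G l) y = 0)
    (hcJ : ∀ y ∈ Metric.closedBall 0 r, pd j c y = (jac G y).det)
    (hdet : ∀ y ∈ Metric.closedBall 0 r,
      pd j (fun y => (Matrix.of fun l m => S l m y).det) y = ∑ m, K m y * pd j (G m) y)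
    (hPδ : ∀ y ∈ Metric.sphere 0 r, δ < nsq P y)
    (hρ : ContDiff ℝ ∞ ρ) (hρδ : ∀ s, δ < s → ρ s = 0) :
    ∫ y in Metric.ball (0 : Cn n) r, Complex.normSq (jac P y).det * ρ (nsq P y) = 0 := by
  set κ : Cn n → ℂ := fun y => (Matrix.of fun l m => S l m y).det with hκdef
  have hκ : ∀ y ∈ Metric.closedBall 0 r, ContDiffAt ℂ ∞ κ y := fun y hy =>
    contDiffAt_det fun l m => hS l m y hy
  set v : Fin n → Cn n → ℂ := fun l y => c y * pd j (G l) y with hvdef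
  have hv : ∀ l, ∀ y ∈ Metric.closedBall 0 r, ContDiffAt ℂ ∞ (v l) y := fun l y hy =>
    (hc y hy).mul (contDiffAt_pd (hG l y hy) j)
  have hPv : ∀ y ∈ Metric.closedBall 0 r, ∑ l, P l y * v l y = 0 := fun y hy => by
    have : ∀ l, P l y * v l y = c y * (P l y * pd j (G l) y) := fun l => by
      simp only [hvdef]
      ring
    simp only [this]
    rw [← Finset.mul_sum, hann y hy, mul_zero]
  have hJ : ∀ y ∈ Metric.closedBall 0 r, ContDiffAt ℂ ∞ (fun y => (jac P y).det) y :=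
    fun y hy => contDiffAt_det_jac fun l => hP l y hy
  have hρ' : ContDiff ℝ ∞ (deriv ρ) := hρ.deriv'
  have hρδ' : ∀ s, δ < s → deriv ρ s = 0 := fun s hs => by
    have : ρ =ᶠ[𝓝 s] fun _ => 0 := (lt_mem_nhds hs).mono fun t ht => hρδ t ht
    rw [this.deriv_eq, deriv_const]
  have hnsq : ContinuousOn (nsq P) (Metric.closedBall 0 r) :=
    continuousOn_nsq fun l => continuousOn_of_contDiffAt (hP l)
  have hρc : ContinuousOn (fun y => (ρ (nsq P y) : ℂ)) (Metric.closedBall 0 r) :=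
    Complex.continuous_ofReal.comp_continuousOn (hρ.continuous.comp_continuousOn hnsq)
  have hρ'c : ContinuousOn (fun y => ((deriv ρ (nsq P y) : ℝ) : ℂ)) (Metric.closedBall 0 r) :=
    Complex.continuous_ofReal.comp_continuousOn (hρ'.continuous.comp_continuousOn hnsq)
  have hJc : ContinuousOn (fun y => conj (jac P y).det) (Metric.closedBall 0 r) :=
    Complex.continuous_conj.comp_continuousOn (continuousOn_of_contDiffAt hJ)
  have hPcc : ∀ l, ContinuousOn (fun y => conj (P l y)) (Metric.closedBall 0 r) := fun l =>
    Complex.continuous_conj.comp_continuousOn (continuousOn_of_contDiffAt (hP l))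
  have hvc := fun l => continuousOn_of_contDiffAt (hv l)
  set A : Fin n → Cn n → ℂ := fun m y =>
    conj (jac P y).det * (K m y * v m y * ρ (nsq P y)) with hA
  set B : Fin n → Fin n → Cn n → ℂ := fun l m y => conj (jac P y).det *
    (κ y * S l m y * (v m y * conj (P l y)) * ((deriv ρ (nsq P y) : ℝ) : ℂ)) with hB
  have hAc : ∀ m, ContinuousOn (A m) (Metric.closedBall 0 r) := fun m =>
    hJc.mul (((continuousOn_of_contDiffAt (hK m)).mul (hvc m)).mul hρc)
  have hBc : ∀ l m, ContinuousOn (B l m) (Metric.closedBall 0 r) := fun l m =>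
    hJc.mul ((((continuousOn_of_contDiffAt hκ).mul (continuousOn_of_contDiffAt (hS l m))).mul
      ((hvc m).mul (hPcc l))).mul hρ'c)
  have hInt : ∀ φ : Cn n → ℂ, ContinuousOn φ (Metric.closedBall 0 r) →
      IntegrableOn φ (Metric.ball 0 r) := fun φ hφ =>
    (hφ.integrableOn_compact (isCompact_closedBall _ _)).mono_set Metric.ball_subset_closedBall
  have hA0 : ∀ m, ∫ y in Metric.ball (0 : Cn n) r, A m y = 0 := fun m =>
    setIntegral_tangent_eq_zero hP (hK m) hv hPv hPδ hρ hρδ m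
  have hB0 : ∀ l m, (∫ y in Metric.ball (0 : Cn n) r, B l m y) +
      ∫ y in Metric.ball (0 : Cn n) r, B m l y = 0 := fun l m => by
    rw [← integral_add (hInt _ (hBc l m)) (hInt _ (hBc m l)),
      ← setIntegral_tangent_symm_eq_zero hP (fun y hy => (hκ y hy).mul (hS l m y hy)) hv hPv hPδ
      hρ' hρδ' m l]
    refine setIntegral_congr_fun measurableSet_ball fun y hy => ?_
    simp only [hB, hsymm m l y (Metric.ball_subset_closedBall hy)]
    ring
  have hBsum : ∑ l, ∑ m, ∫ y in Metric.ball (0 : Cn n) r, B l m y = 0 := by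
    have h2 : ∑ l, ∑ m, ((∫ y in Metric.ball (0 : Cn n) r, B l m y) +
        ∫ y in Metric.ball (0 : Cn n) r, B m l y) = 0 :=
      Finset.sum_eq_zero fun l _ => Finset.sum_eq_zero fun m _ => hB0 l m
    simp only [Finset.sum_add_distrib] at h2
    rw [Finset.sum_comm (f := fun l m => ∫ y in Metric.ball (0 : Cn n) r, B m l y)] at h2
    exact self_eq_neg.1 (eq_neg_of_add_eq_zero_left h2)
  have hdiv := setIntegral_divergence_eq_zero (P := P) (H := fun y => (jac P y).det)
    (W := fun a y => if a = j then κ y * c y else 0) hP hJ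
    (fun a y hy => by
      split_ifs
      exacts [(hκ y hy).mul (hc y hy), contDiffAt_const]) hPδ hρ hρδ
  have key : ∀ y ∈ Metric.ball (0 : Cn n) r, conj (jac P y).det *
      ((∑ a, pd a (fun y => if a = j then κ y * c y else 0) y) * ρ (nsq P y) +
      ((deriv ρ (nsq P y) : ℝ) : ℂ) * ∑ l, conj (P l y) * ∑ a, pd a (P l) y *
        if a = j then κ y * c y else 0) =
      (∑ m, A m y + ∑ l, ∑ m, B l m y) +
        ((Complex.normSq (jac P y).det * ρ (nsq P y) : ℝ) : ℂ) := by
    intro y hy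
    have hy := Metric.ball_subset_closedBall hy
    have h1 : ∑ a, pd a (fun y => if a = j then κ y * c y else 0) y =
        (∑ m, K m y * v m y) + (jac P y).det := by
      rw [Finset.sum_eq_single j (fun a _ ha => by simp [ha, pd_const]) (by simp)]
      simp only [if_true]
      rw [pd_mul (hκ y hy) (hc y hy), hdet y hy, hcJ y hy, Finset.sum_mul]
      congr 1
      · refine Finset.sum_congr rfl fun m _ => ?_
        simp only [hvdef]
        ring
      · rw [hκdef, ← Matrix.det_mul]
        congr 1
        ext l a
        exact (hPG l a y hy).symm
    have h2 : ∀ l, (∑ a, pd a (P l) y * if a = j then κ y * c y else 0) =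
        ∑ m, κ y * S l m y * v m y := by
      intro l
      simp only [mul_ite, mul_zero, Finset.sum_ite_eq', Finset.mem_univ, if_true]
      rw [hPG l j y hy, Finset.sum_mul]
      refine Finset.sum_congr rfl fun m _ => ?_
      simp only [hvdef]
      ring
    have h3 : ∀ l m, κ y * S l m y * (v m y * conj (P l y)) =
        conj (P l y) * (κ y * S l m y * v m y) := fun l m => by ring
    simp only [h1, h2, hA, hB, h3]
    rw [Complex.ofReal_mul, Complex.normSq_eq_conj_mul_self]
    simp only [← Finset.mul_sum, ← Finset.sum_mul]
    ring
  rw [setIntegral_congr_fun measurableSet_ball key, integral_add, integral_add,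
    setIntegral_sum_eq hAc, setIntegral_sum_eq] at hdiv
  · simp only [setIntegral_sum_eq (hBc _)] at hdiv
    rw [hBsum, Finset.sum_eq_zero fun m _ => hA0 m, zero_add, zero_add,
      integral_complex_ofReal] at hdiv
    exact_mod_cast hdiv
  · exact fun l => continuousOn_finsetSum _ fun m _ => hBc l m
  · exact hInt _ (continuousOn_finsetSum _ fun m _ => hAc m)
  · exact hInt _ (continuousOn_finsetSum _ fun l _ => continuousOn_finsetSum _ fun m _ => hBc l m)
  · exact hInt _ ((continuousOn_finsetSum _ fun m _ => hAc m).add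
      (continuousOn_finsetSum _ fun l _ => continuousOn_finsetSum _ fun m _ => hBc l m))
  · refine hInt _ (Complex.continuous_ofReal.comp_continuousOn (ContinuousOn.mul ?_ ?_))
    · exact Complex.continuous_normSq.comp_continuousOn (continuousOn_of_contDiffAt hJ)
    · exact hρ.continuous.comp_continuousOn hnsq

theorem contDiffAt_infty_comp {n m : ℕ} {f : Cn m → ℂ} {g : Cn n → Cn m} {y : Cn n}
    (hf : ContDiffAt ℂ ∞ f (g y)) (hg : ContDiffAt ℂ ∞ g y) :
    ContDiffAt ℂ ∞ (fun y => f (g y)) y :=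
  hf.comp y hg

theorem update_mem_ball {n : ℕ} {r : ℝ} {y : Cn n} (hy : y ∈ Metric.ball 0 r) {i : Fin n} {w : ℂ}
    (hw : ‖w‖ < r) : Function.update y i w ∈ Metric.ball (0 : Cn n) r := by
  have hr : 0 < r := (norm_nonneg w).trans_lt hw
  rw [mem_ball_zero_iff, pi_norm_lt_iff hr] at *
  intro l
  rcases eq_or_ne l i with rfl | h
  · simpa using hw
  · simpa [h] using hy l

theorem norm_apply_lt_of_mem_ball {n : ℕ} {r : ℝ} {y : Cn n} (hy : y ∈ Metric.ball 0 r)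
    (i : Fin n) : ‖y i‖ < r :=
  (norm_le_pi_norm y i).trans_lt (mem_ball_zero_iff.1 hy)

theorem norm_ofReal_mul_lt {r τ : ℝ} {w : ℂ} (hτ : τ ∈ Icc (0 : ℝ) 1) (hw : ‖w‖ < r) :
    ‖(τ : ℂ) * w‖ < r := by
  rw [norm_mul, Complex.norm_real, Real.norm_of_nonneg hτ.1]
  nlinarith [norm_nonneg w, hτ.2]

/-- The average of `h` over the segment joining `y` to its projection to `y i = 0`. -/
def segmentAverage {n : ℕ} (i : Fin n) (h : Cn n → ℂ) (y : Cn n) : ℂ :=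
  ∫ τ in (0 : ℝ)..1, h (Function.update y i (τ * y i))

theorem differentiableOn_segmentAverage {n : ℕ} {r : ℝ} {h : Cn n → ℂ} (i : Fin n)
    (hh : DifferentiableOn ℂ h (Metric.ball 0 r)) :
    DifferentiableOn ℂ (segmentAverage i h) (Metric.ball 0 r) := by
  have hmem : ∀ y ∈ Metric.ball (0 : Cn n) r, ∀ τ ∈ uIcc (0 : ℝ) 1,
      Function.update y i (τ * y i) ∈ Metric.ball (0 : Cn n) r := fun y hy τ hτ =>
    update_mem_ball hy (norm_ofReal_mul_lt (by simpa using hτ) (norm_apply_lt_of_mem_ball hy i))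
  refine differentiableOn_intervalIntegral Metric.isOpen_ball ?_ fun τ hτ => ?_
  · refine hh.continuousOn.comp (f := fun q : Cn n × ℝ => Function.update q.1 i (q.2 * q.1 i))
      (Continuous.continuousOn ?_) fun q hq => hmem q.1 hq.1 q.2 hq.2
    exact continuous_fst.update i (by fun_prop)
  · refine hh.comp (f := fun y : Cn n => Function.update y i (τ * y i)) ?_
      fun y hy => hmem y hy τ hτ
    refine (differentiable_pi.2 fun l => ?_).differentiableOn
    rcases eq_or_ne l i with rfl | h
    · simp only [Function.update_self]
      fun_prop
    · simp only [Function.update_of_ne h]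
      fun_prop

theorem mul_integral_ray_eq_sub {r : ℝ} {φ G : ℂ → ℂ} (hφ : ContinuousOn φ (Metric.ball 0 r))
    (hG : ∀ w ∈ Metric.ball (0 : ℂ) r, HasDerivAt G (φ w) w) {w : ℂ} (hw : w ∈ Metric.ball 0 r) :
    w * ∫ τ in (0 : ℝ)..1, φ (τ * w) = G w - G 0 := by
  have hmem : ∀ τ ∈ uIcc (0 : ℝ) 1, (τ : ℂ) * w ∈ Metric.ball (0 : ℂ) r := fun τ hτ =>
    mem_ball_zero_iff.2 (norm_ofReal_mul_lt (by simpa using hτ) (mem_ball_zero_iff.1 hw))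
  have h1 : ∀ τ ∈ uIcc (0 : ℝ) 1, HasDerivAt (fun τ : ℝ => G (τ * w)) (φ (τ * w) * w) τ := by
    intro τ hτ
    have := (hG _ (hmem τ hτ)).comp (τ : ℂ) ((hasDerivAt_id (τ : ℂ)).mul_const w)
    simpa using this.comp_ofReal
  have h2 : ContinuousOn (fun τ : ℝ => φ (τ * w) * w) (uIcc 0 1) :=
    (hφ.comp (f := fun τ : ℝ => (τ : ℂ) * w) (by fun_prop) hmem).mul continuousOn_const
  have := intervalIntegral.integral_eq_sub_of_hasDerivAt h1 h2.intervalIntegrable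
  rw [intervalIntegral.integral_mul_const] at this
  simpa [mul_comm] using this

theorem hasDerivAt_update_of_mem_ball {n : ℕ} {r : ℝ} {h : Cn n → ℂ} {y : Cn n} {i : Fin n}
    (hh : ∀ y ∈ Metric.ball 0 r, ContDiffAt ℂ ∞ h y) (hy : y ∈ Metric.ball 0 r) {w : ℂ}
    (hw : w ∈ Metric.ball (0 : ℂ) r) :
    HasDerivAt (fun w => h (Function.update y i w)) (pd i h (Function.update y i w)) w := by
  have hd := ((hh _ (update_mem_ball hy (mem_ball_zero_iff.1 hw))).differentiableAt
    (by simp)).hasFDerivAt.comp_hasDerivAt w (hasDerivAt_update y i w)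
  exact hd

theorem exists_pd_eq {n : ℕ} {h : Cn n → ℂ} (hh : ContDiffAt ℂ ∞ h 0) (i : Fin n) :
    ∃ c : Cn n → ℂ, ContDiffAt ℂ ∞ c 0 ∧ ∀ᶠ y in 𝓝 0, pd i c y = h y := by
  obtain ⟨r, hr, hhr⟩ := Metric.eventually_nhds_iff_ball.1 hh.eventually_infty
  have hd : DifferentiableOn ℂ h (Metric.ball 0 r) := fun y hy =>
    ((hhr y hy).differentiableAt (by simp)).differentiableWithinAt
  have hc : ∀ y ∈ Metric.ball (0 : Cn n) r,
      ContDiffAt ℂ ∞ (fun y => y i * segmentAverage i h y) y := fun y hy =>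
    (contDiffAt_pi.1 contDiffAt_id i).mul
      ((contDiffOn_infty_of_isOpen Metric.isOpen_ball
        (differentiableOn_segmentAverage i hd)).contDiffAt (Metric.isOpen_ball.mem_nhds hy))
  refine ⟨fun y => y i * segmentAverage i h y, hc 0 (Metric.mem_ball_self hr), ?_⟩
  filter_upwards [Metric.ball_mem_nhds (0 : Cn n) hr] with y hy
  have hφ : DifferentiableOn ℂ (fun w => h (Function.update y i w)) (Metric.ball 0 r) :=
    fun w hw => (hasDerivAt_update_of_mem_ball hhr hy hw).differentiableAt.differentiableWithinAt
  obtain ⟨G, hG⟩ := hφ.isExactOn_ball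
  have hyi : y i ∈ Metric.ball (0 : ℂ) r := mem_ball_zero_iff.2 (norm_apply_lt_of_mem_ball hy i)
  refine pd_eq_of_hasDerivAt (hc y hy) ?_
  have h1 : HasDerivAt (fun t : ℂ => G (y i + t) - G 0) (h y) 0 := by
    have := (hG (y i + 0) (by simpa using hyi)).comp_const_add (y i) 0
    simpa using this.sub_const (G 0)
  refine h1.congr_of_eventuallyEq ?_
  have h2 : ∀ᶠ t : ℂ in 𝓝 0, y i + t ∈ Metric.ball (0 : ℂ) r :=
    (continuous_const.add continuous_id).continuousAt.eventually
      (Metric.isOpen_ball.mem_nhds (by simpa using hyi))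
  filter_upwards [h2] with t ht
  rw [← mul_integral_ray_eq_sub hφ.continuousOn hG ht]
  have h3 : y + t • Pi.single i 1 = Function.update y i (y i + t) := by
    ext l
    rcases eq_or_ne l i with rfl | hl
    · simp
    · simp [hl]
  simp [h3, segmentAverage]

theorem eventually_eq_mul_of_eq_zero {n : ℕ} {a : Cn n → ℂ} (ha : ContDiffAt ℂ ∞ a 0) (i : Fin n)
    (h0 : ∀ᶠ y in 𝓝 0, y i = 0 → a y = 0) :
    ∃ b : Cn n → ℂ, ContDiffAt ℂ ∞ b 0 ∧ ∀ᶠ y in 𝓝 0, a y = y i * b y := by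
  obtain ⟨r, hr, hhr⟩ := Metric.eventually_nhds_iff_ball.1 (ha.eventually_infty.and h0)
  have hpd : ∀ y ∈ Metric.ball (0 : Cn n) r, ContDiffAt ℂ ∞ (pd i a) y := fun y hy =>
    contDiffAt_pd (hhr y hy).1 i
  have hd : DifferentiableOn ℂ (pd i a) (Metric.ball 0 r) := fun y hy =>
    ((hpd y hy).differentiableAt (by simp)).differentiableWithinAt
  refine ⟨segmentAverage i (pd i a), (contDiffOn_infty_of_isOpen Metric.isOpen_ball
    (differentiableOn_segmentAverage i hd)).contDiffAt (Metric.ball_mem_nhds _ hr), ?_⟩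
  filter_upwards [Metric.ball_mem_nhds (0 : Cn n) hr] with y hy
  have hyi : y i ∈ Metric.ball (0 : ℂ) r := mem_ball_zero_iff.2 (norm_apply_lt_of_mem_ball hy i)
  have h1 := mul_integral_ray_eq_sub (r := r) (w := y i)
    (φ := fun w => pd i a (Function.update y i w)) (G := fun w => a (Function.update y i w))
    (fun w hw => (hasDerivAt_update_of_mem_ball hpd hy
      hw).differentiableAt.continuousAt.continuousWithinAt)
    (fun w hw => hasDerivAt_update_of_mem_ball (fun y hy => (hhr y hy).1) hy hw) hyi
  have h2 : a (Function.update y i 0) = 0 :=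
    (hhr _ (update_mem_ball hy (by simpa using hr))).2 (by simp)
  simp only [h2, sub_zero, Function.update_eq_self] at h1
  exact h1.symm

/-- A holomorphic function with an isolated critical zero cannot be pulled back by a finite map
germ to a power of a coordinate function. -/
theorem not_comp_eventuallyEq_coord_pow {n k : ℕ} {i j : Fin n} (hij : i ≠ j) (hk : k ≠ 0)
    {g : Cn n → Cn n} {f : Cn n → ℂ} (hg : ContDiffAt ℂ ∞ g 0) (hg0 : g 0 = 0)
    (hiso : ∀ᶠ y in 𝓝 0, g y = 0 → y = 0) (hf : ContDiffAt ℂ ∞ f 0)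
    (hdf0 : ∀ l, pd l f 0 = 0)
    (hfiso : ∀ᶠ x in 𝓝 0, f x = 0 → (∀ l, pd l f x = 0) → x = 0) :
    ¬ ∀ᶠ y in 𝓝 0, f (g y) = y i ^ k := by
  intro hfg
  have hgt : Tendsto g (𝓝 0) (𝓝 0) := by
    simpa [hg0] using hg.continuousAt.tendsto
  obtain ⟨c, hc, hcJ⟩ := exists_pd_eq (h := fun y => (jac (fun l y => g y l) y).det)
    (contDiffAt_det_jac fun l => contDiffAt_pi.1 hg l) j
  obtain ⟨r, hr, hB⟩ := Metric.nhds_basis_closedBall.eventually_iff.1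
    (hg.eventually_infty_pi.and ((hgt.eventually hf.eventually_infty).and
    (hfg.eventually_nhds.and (hiso.and ((hgt.eventually hfiso).and
    (hc.eventually_infty.and hcJ))))))
  have hgB : ∀ y ∈ Metric.closedBall (0 : Cn n) r, ContDiffAt ℂ ∞ g y := fun y hy => (hB hy).1
  have hfB : ∀ y ∈ Metric.closedBall (0 : Cn n) r, ContDiffAt ℂ ∞ f (g y) :=
    fun y hy => (hB hy).2.1
  have hpow : ∀ y ∈ Metric.closedBall (0 : Cn n) r, ∀ a,
      ∑ l, pd l f (g y) * pd a (fun y => g y l) y = pd a (fun y => y i ^ k) y := fun y hy a => by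
    rw [← pd_comp (hfB y hy) (hgB y hy)]
    exact pd_congr (hB hy).2.2.1 a
  have hcoord : ∀ y : Cn n, ContDiffAt ℂ ∞ (fun y : Cn n => y i ^ k) y := fun y =>
    (contDiffAt_pi.1 contDiffAt_id i).pow k
  set P : Fin n → Cn n → ℂ := fun l y => pd l f (g y) with hPdef
  have hP : ∀ l, ∀ y ∈ Metric.closedBall 0 r, ContDiffAt ℂ ∞ (P l) y := fun l y hy =>
    contDiffAt_infty_comp (contDiffAt_pd (hfB y hy) l) (hgB y hy)
  have hPne : ∀ y ∈ Metric.sphere (0 : Cn n) r, ∃ l, P l y ≠ 0 := by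
    intro y hy
    by_contra! h
    have hyB := Metric.sphere_subset_closedBall hy
    have h1 := hpow y hyB i
    rw [Finset.sum_eq_zero fun l _ => by rw [show pd l f (g y) = 0 from h l, zero_mul],
      pd_eq_of_hasDerivAt (c := k * y i ^ (k - 1)) (hcoord y)] at h1
    · have hyi : y i = 0 := by
        rcases mul_eq_zero.1 h1.symm with h2 | h2
        · exact absurd (Nat.cast_eq_zero.1 h2) hk
        · exact eq_zero_of_pow_eq_zero h2
      have hfy : f (g y) = 0 := by
        rw [(hB hyB).2.2.1.self_of_nhds, hyi, zero_pow hk]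
      have := (hB hyB).2.2.2.1 ((hB hyB).2.2.2.2.1 hfy h)
      rw [this] at hy
      simp [hr.ne] at hy
    · have := ((hasDerivAt_id (0 : ℂ)).const_add (y i)).fun_pow k
      simpa using this
  have hP0 : ∀ l, P l 0 = 0 := fun l => by simp [hPdef, hg0, hdf0]
  obtain ⟨δ, hδ, hsph⟩ := exists_pos_forall_lt_of_isCompact (isCompact_sphere (0 : Cn n) r)
    ((continuousOn_nsq fun l => continuousOn_of_contDiffAt (hP l)).mono
      Metric.sphere_subset_closedBall) fun y hy => nsq_pos (hPne y hy)
  have hpd2 : ∀ l m, ∀ y ∈ Metric.closedBall (0 : Cn n) r, ContDiffAt ℂ ∞ (pd m (pd l f)) (g y) :=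
    fun l m y hy => contDiffAt_pd (contDiffAt_pd (hfB y hy) l) m
  have hdet : ∀ y ∈ Metric.closedBall (0 : Cn n) r,
      ContDiffAt ℂ ∞ (fun x => (Matrix.of fun l m => pd m (pd l f) x).det) (g y) :=
    fun y hy => contDiffAt_det fun l m => hpd2 l m y hy
  refine (degree_integral_pos hr hδ hP hP0 hsph).ne' ?_
  refine degree_integral_eq_zero (G := fun l y => g y l)
    (K := fun l y => pd l (fun x => (Matrix.of fun l m => pd m (pd l f) x).det) (g y))
    (S := fun l m y => pd m (pd l f) (g y)) (c := c) j hP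
    (fun l y hy => contDiffAt_pi.1 (hgB y hy) l) ?_ ?_ (fun y hy => (hB hy).2.2.2.2.2.1)
    ?_ ?_ ?_ (fun y hy => (hB hy).2.2.2.2.2.2) ?_ hsph (contDiff_bump δ) fun s => bump_eq_zero
  · exact fun l y hy => contDiffAt_infty_comp (contDiffAt_pd (hdet y hy) l) (hgB y hy)
  · exact fun l m y hy => contDiffAt_infty_comp (hpd2 l m y hy) (hgB y hy)
  · exact fun l m y hy => pd_comm (hfB y hy) m l
  · exact fun l a y hy => pd_comp (contDiffAt_pd (hfB y hy) l) (hgB y hy) a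
  · intro y hy
    rw [hpow y hy j]
    refine pd_eq_of_hasDerivAt (hcoord y) ?_
    simpa [hij] using hasDerivAt_const (0 : ℂ) (y i ^ k)
  · exact fun y hy => pd_comp (hdet y hy) (hgB y hy) j

theorem ContDiffAt.analyticAt_comp_line {n : ℕ} {f : Cn n → ℂ} {p : Cn n}
    (hf : ContDiffAt ℂ ∞ f p) (e : Cn n) : AnalyticAt ℂ (fun ζ : ℂ => f (p + ζ • e)) 0 := by
  rw [Complex.analyticAt_iff_eventually_differentiableAt]
  have hc : Tendsto (fun ζ : ℂ => p + ζ • e) (𝓝 0) (𝓝 p) :=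
    Continuous.tendsto' (by fun_prop) _ _ (by simp)
  filter_upwards [hc.eventually hf.eventually_infty] with ζ hζ
  exact (hζ.differentiableAt (by simp)).comp ζ (f := fun ζ : ℂ => p + ζ • e) (by fun_prop)

theorem exists_pd_ne_zero {n : ℕ} {φ : Cn n → ℂ} {p : Cn n} (h : fderiv ℂ φ p ≠ 0) :
    ∃ i, pd i φ p ≠ 0 := by
  contrapose! h
  ext v
  rw [clm_apply_eq_sum]
  refine Finset.sum_eq_zero fun i _ => ?_
  have := h i
  simp only [pd] at this
  rw [this, zero_mul]

theorem fderiv_ne_zero_of_pd_ne_zero {n : ℕ} {φ : Cn n → ℂ} {p : Cn n} {i : Fin n}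
    (h : pd i φ p ≠ 0) : fderiv ℂ φ p ≠ 0 := by
  contrapose! h
  simp [pd, h]

/-- A submersive holomorphic function is a coordinate in suitable local coordinates. -/
theorem exists_straightening {n : ℕ} {φ : Cn n → ℂ} {p : Cn n} (hφ : ContDiffAt ℂ ∞ φ p)
    (hp : φ p = 0) {i : Fin n} (hi : pd i φ p ≠ 0) :
    ∃ Φ Ψ : Cn n → Cn n, ContDiffAt ℂ ∞ Φ p ∧ ContDiffAt ℂ ∞ Ψ 0 ∧ Φ p = 0 ∧ Ψ 0 = p ∧
      (∀ᶠ y in 𝓝 0, Φ (Ψ y) = y) ∧ (∀ᶠ x in 𝓝 p, Ψ (Φ x) = x) ∧ ∀ x, Φ x i = φ x := by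
  set Φ : Cn n → Cn n := fun x => Function.update (x - p) i (φ x) with hΦdef
  have hΦ : ContDiffAt ℂ ∞ Φ p := by
    rw [contDiffAt_pi]
    intro l
    rcases eq_or_ne l i with rfl | h
    · simpa [hΦdef] using hφ
    · simp only [hΦdef, Function.update_of_ne h]
      fun_prop
  have hΦp : Φ p = 0 := by
    ext l
    rcases eq_or_ne l i with rfl | h
    · simpa [hΦdef] using hp
    · simp [hΦdef, h]
  have hd := (hΦ.differentiableAt (by simp)).hasFDerivAt
  have hval : ∀ v l, fderiv ℂ Φ p v l = Function.update v i (fderiv ℂ φ p v) l := by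
    intro v l
    have h1 := (hasFDerivAt_pi'.1 hd l)
    rcases eq_or_ne l i with rfl | h
    · have h2 := (hφ.differentiableAt (by simp)).hasFDerivAt
      have h3 : (fun x => Φ x l) = φ := by ext x; simp [hΦdef]
      rw [h3] at h1
      simpa using congrArg (fun L => L v) (h1.unique h2)
    · have h3 : (fun x => Φ x l) = fun x => x l - p l := by ext x; simp [hΦdef, h]
      rw [h3] at h1
      have h2 : HasFDerivAt (fun x : Cn n => x l - p l)
          (ContinuousLinearMap.proj l : Cn n →L[ℂ] ℂ) p :=
        (ContinuousLinearMap.proj l : Cn n →L[ℂ] ℂ).hasFDerivAt.sub_const _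
      simpa [h] using congrArg (fun L => L v) (h1.unique h2)
  have hinj : Function.Injective (fderiv ℂ Φ p : Cn n →ₗ[ℂ] Cn n) := by
    rw [← LinearMap.ker_eq_bot, LinearMap.ker_eq_bot']
    intro v hv
    have hv' : ∀ l, Function.update v i (fderiv ℂ φ p v) l = 0 := fun l => by
      rw [← hval]; exact congrFun hv l
    have hne : ∀ l, l ≠ i → v l = 0 := fun l h => by simpa [h] using hv' l
    have h1 : fderiv ℂ φ p v = 0 := by simpa using hv' i
    rw [clm_apply_eq_sum, Finset.sum_eq_single i (fun l _ h => by simp [hne l h]) (by simp)] at h1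
    ext l
    rcases eq_or_ne l i with rfl | h
    · exact (mul_eq_zero.1 h1).resolve_left hi
    · exact hne l h
  set A : Cn n ≃L[ℂ] Cn n :=
    (LinearEquiv.ofInjectiveEndo (fderiv ℂ Φ p : Cn n →ₗ[ℂ] Cn n) hinj).toContinuousLinearEquiv
  have hA : (A : Cn n →L[ℂ] Cn n) = fderiv ℂ Φ p := by
    ext v
    rfl
  have hd' : HasFDerivAt Φ (A : Cn n →L[ℂ] Cn n) p := hA ▸ hd
  have hn : (∞ : WithTop ℕ∞) ≠ 0 := by simp
  refine ⟨Φ, hΦ.localInverse hd' hn, hΦ, ?_, hΦp, ?_, ?_, ?_, fun x => by simp [hΦdef]⟩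
  · have := hΦ.to_localInverse hd' hn
    rwa [hΦp] at this
  · have := hΦ.localInverse_apply_image hd' hn
    rwa [hΦp] at this
  · have := (hΦ.hasStrictFDerivAt' hd' hn).eventually_right_inverse
    rwa [hΦp] at this
  · exact (hΦ.hasStrictFDerivAt' hd' hn).eventually_left_inverse

theorem exists_root_of_ne_zero {n : ℕ} {u : Cn n → ℂ} {x : Cn n} (hu : ContDiffAt ℂ ∞ u x)
    (hux : u x ≠ 0) {k : ℕ} (hk : k ≠ 0) :
    ∃ v : Cn n → ℂ, ContDiffAt ℂ ∞ v x ∧ v x ≠ 0 ∧ ∀ᶠ y in 𝓝 x, v y ^ k = u y := by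
  obtain ⟨c, hc⟩ := IsAlgClosed.exists_pow_nat_eq (u x) (Nat.pos_of_ne_zero hk)
  have hc0 : c ≠ 0 := by
    rintro rfl
    exact hux (by rw [← hc, zero_pow hk])
  have hq : ContDiffAt ℂ ∞ (fun y => u y / u x) x := hu.div_const _
  have hslit : u x / u x ∈ Complex.slitPlane := by
    rw [div_self hux]; exact Complex.one_mem_slitPlane
  refine ⟨fun y => c * Complex.exp (Complex.log (u y / u x) / k), ?_, ?_, ?_⟩
  · exact contDiffAt_const.mul ((ContDiffAt.comp (g := Complex.log) x
      (Complex.contDiffAt_log hslit) hq).div_const _).cexp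
  · exact mul_ne_zero hc0 (Complex.exp_ne_zero _)
  · filter_upwards [hu.continuousAt.eventually_ne hux] with y hy
    rw [mul_pow, hc, ← Complex.exp_nat_mul, mul_div_cancel₀ _ (Nat.cast_ne_zero.2 hk),
      Complex.exp_log (div_ne_zero hy hux), mul_div_cancel₀ _ hux]

theorem eventually_eq_zero_of_ne_zero_off {n : ℕ} {b : Cn n → ℂ} (hb : ContDiffAt ℂ ∞ b 0)
    (hb0 : b 0 = 0) (i : Fin n) (hne : ∀ᶠ y in 𝓝 0, y i ≠ 0 → b y ≠ 0) :
    ∀ᶠ y in 𝓝 0, y i = 0 → b y = 0 := by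
  obtain ⟨R, hR, hball⟩ := Metric.eventually_nhds_iff_ball.1 (hb.eventually_infty.and hne)
  set e : Cn n := Pi.single i 1 with he
  set r := R / 2 with hr
  have hr0 : 0 < r := half_pos hR
  have hnorm : ∀ ζ : ℂ, ‖ζ • e‖ = ‖ζ‖ := fun ζ => by simp [he, norm_smul, Pi.norm_single]
  have hmem : ∀ y : Cn n, ‖y‖ < r → ∀ ζ : ℂ, ‖ζ‖ ≤ r → y + ζ • e ∈ Metric.ball (0 : Cn n) R := by
    intro y hy ζ hζ
    rw [mem_ball_zero_iff]
    calc ‖y + ζ • e‖ ≤ ‖y‖ + ‖ζ • e‖ := norm_add_le _ _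
      _ < R := by rw [hnorm]; linarith
  have hcont : ∀ y : Cn n, ‖y‖ < r → ∀ ζ : ℂ, ‖ζ‖ ≤ r → ContinuousAt b (y + ζ • e) :=
    fun y hy ζ hζ => (hball _ (hmem y hy ζ hζ)).1.continuousAt
  have hcoord : ∀ y : Cn n, y i = 0 → ∀ ζ : ℂ, (y + ζ • e) i = ζ := fun y hy ζ => by simp [hy, he]
  obtain ⟨δ, hδ, hδK⟩ := exists_pos_forall_lt_of_isCompact (K := Metric.sphere (0 : ℂ) r)
    (f := fun ζ => ‖b (0 + ζ • e)‖) (isCompact_sphere _ _)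
    (fun ζ hζ => ContinuousAt.continuousWithinAt (by
      have h1 := hcont 0 (by simpa using hr0) ζ (mem_sphere_zero_iff_norm.1 hζ).le
      have h2 : ContinuousAt (fun ζ : ℂ => (0 : Cn n) + ζ • e) ζ := by fun_prop
      exact (ContinuousAt.comp (f := fun ζ : ℂ => (0 : Cn n) + ζ • e) h1 h2).norm))
    (fun ζ hζ => norm_pos_iff.2 ((hball _ (hmem 0 (by simpa using hr0) ζ
      (mem_sphere_zero_iff_norm.1 hζ).le)).2 (by
        rw [hcoord 0 rfl]; rintro rfl; simp at hζ; exact hr0.ne hζ)))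
  have hnear : ∀ᶠ y in 𝓝 (0 : Cn n), ∀ ζ ∈ Metric.sphere (0 : ℂ) r, δ < ‖b (y + ζ • e)‖ := by
    refine (isCompact_sphere _ _).eventually_forall_of_forall_eventually fun ζ hζ => ?_
    have h1 := hcont 0 (by simpa using hr0) ζ (mem_sphere_zero_iff_norm.1 hζ).le
    have h2 : ContinuousAt (fun q : Cn n × ℂ => q.1 + q.2 • e) (0, ζ) := by fun_prop
    have h3 := (ContinuousAt.comp (f := fun q : Cn n × ℂ => q.1 + q.2 • e) h1 h2).norm
    exact h3.eventually (lt_mem_nhds (hδK ζ hζ))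
  have hsmall : ∀ᶠ y in 𝓝 (0 : Cn n), ‖b y‖ < δ :=
    hb.continuousAt.norm.eventually (gt_mem_nhds (by simpa [hb0] using hδ))
  filter_upwards [hnear, hsmall, Metric.ball_mem_nhds (0 : Cn n) hr0] with y h1 h2 h3 hyi
  by_contra hby
  rw [mem_ball_zero_iff] at h3
  have hnz : ∀ ζ : ℂ, ‖ζ‖ ≤ r → b (y + ζ • e) ≠ 0 := by
    intro ζ hζ
    rcases eq_or_ne ζ 0 with rfl | h
    · simpa using hby
    · exact (hball _ (hmem y h3 ζ hζ)).2 (by rwa [hcoord y hyi])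
  have hdiff : DifferentiableOn ℂ (fun ζ : ℂ => (b (y + ζ • e))⁻¹) (Metric.closedBall 0 r) := by
    intro ζ hζ
    rw [mem_closedBall_zero_iff] at hζ
    have h4 := (hball _ (hmem y h3 ζ hζ)).1.differentiableAt (by simp)
    have h5 : DifferentiableAt ℂ (fun ζ : ℂ => b (y + ζ • e)) ζ :=
      h4.comp ζ (f := fun ζ : ℂ => y + ζ • e) (by fun_prop)
    exact (h5.inv (hnz ζ hζ)).differentiableWithinAt
  have hbound := Complex.norm_le_of_forall_mem_frontier_norm_le (C := δ⁻¹) (z := (0 : ℂ))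
    Metric.isBounded_ball (hdiff.diffContOnCl_ball subset_rfl) (fun ζ hζ => by
      rw [frontier_ball _ hr0.ne'] at hζ
      rw [norm_inv]
      exact inv_anti₀ hδ (h1 ζ hζ).le) (subset_closure (Metric.mem_ball_self hr0))
  rw [zero_smul, add_zero, norm_inv] at hbound
  exact absurd ((inv_le_inv₀ (norm_pos_iff.2 hby) hδ).1 hbound) (not_le.2 h2)

theorem exists_eq_coord_pow_mul {n : ℕ} {a : Cn n → ℂ} (ha : ContDiffAt ℂ ∞ a 0) {i : Fin n}
    (hz : ∀ᶠ y in 𝓝 0, a y = 0 ↔ y i = 0) :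
    ∃ (k : ℕ) (u : Cn n → ℂ), k ≠ 0 ∧ ContDiffAt ℂ ∞ u 0 ∧ u 0 ≠ 0 ∧
      ∀ᶠ y in 𝓝 0, a y = y i ^ k * u y := by
  set e : Cn n := Pi.single i 1 with he
  have ht : Tendsto (fun ζ : ℂ => (0 : Cn n) + ζ • e) (𝓝 0) (𝓝 0) :=
    Continuous.tendsto' (by fun_prop) _ _ (by simp)
  have hcoord : ∀ ζ : ℂ, ((0 : Cn n) + ζ • e) i = ζ := fun ζ => by simp [he]
  have hline := ha.analyticAt_comp_line e
  have hfin : analyticOrderAt (fun ζ : ℂ => a (0 + ζ • e)) 0 ≠ ⊤ := by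
    rw [Ne, analyticOrderAt_eq_top]
    intro h
    have h1 : ∀ᶠ ζ : ℂ in 𝓝 0, ζ = 0 := by
      filter_upwards [h, ht.eventually hz] with ζ h1 h2
      rw [← hcoord ζ]
      exact h2.1 h1
    have h2 : ∃ᶠ ζ : ℂ in 𝓝[≠] 0, ζ = 0 := (h1.filter_mono nhdsWithin_le_nhds).frequently
    exact h2 (eventually_mem_nhdsWithin.mono fun ζ h => h)
  by_contra! hno
  have key : ∀ k : ℕ, ∃ b : Cn n → ℂ, ContDiffAt ℂ ∞ b 0 ∧ ∀ᶠ y in 𝓝 0, a y = y i ^ k * b y := by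
    intro k
    induction k with
    | zero => exact ⟨a, ha, by simp⟩
    | succ k ih =>
      obtain ⟨b, hb, hab⟩ := ih
      have hb0 : b 0 = 0 := by
        by_contra hb0
        rcases eq_or_ne k 0 with rfl | hk
        · refine hb0 ?_
          have h1 := hab.self_of_nhds
          rw [hz.self_of_nhds.2 rfl] at h1
          simpa using h1.symm
        · exact hno k b hk hb hb0 (hab.mono fun y h => not_not.2 h)
      obtain ⟨c, hc, hbc⟩ := eventually_eq_mul_of_eq_zero hb i
        (eventually_eq_zero_of_ne_zero_off hb hb0 i (by
          filter_upwards [hab, hz] with y h1 h2 h3 h4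
          exact h3 (h2.1 (by rw [h1, h4, mul_zero]))))
      refine ⟨c, hc, ?_⟩
      filter_upwards [hab, hbc] with y h1 h2
      rw [h1, h2]
      ring
  obtain ⟨N, hN⟩ := ENat.ne_top_iff_exists.1 hfin
  obtain ⟨b, hb, hab⟩ := key (N + 1)
  have : ((N + 1 : ℕ) : ℕ∞) ≤ analyticOrderAt (fun ζ : ℂ => a (0 + ζ • e)) 0 := by
    rw [natCast_le_analyticOrderAt hline]
    refine ⟨_, hb.analyticAt_comp_line e, ?_⟩
    filter_upwards [ht.eventually hab] with ζ h
    rw [h, hcoord, sub_zero, smul_eq_mul]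
  rw [← hN] at this
  exact absurd (by exact_mod_cast this) (Nat.not_succ_le_self N)

/-- A holomorphic function with the same zeros as a submersive one is a power of a submersive
one. -/
theorem exists_eq_pow_of_zeros {n : ℕ} {a l : Cn n → ℂ} {x : Cn n} (ha : ContDiffAt ℂ ∞ a x)
    (hl : ContDiffAt ℂ ∞ l x) (hlx : l x = 0) {i : Fin n} (hi : pd i l x ≠ 0)
    (hz : ∀ᶠ y in 𝓝 x, a y = 0 ↔ l y = 0) :
    ∃ (k : ℕ) (s : Cn n → ℂ), k ≠ 0 ∧ ContDiffAt ℂ ∞ s x ∧ s x = 0 ∧ pd i s x ≠ 0 ∧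
      ∀ᶠ y in 𝓝 x, a y = s y ^ k := by
  obtain ⟨Φ, Ψ, hΦ, hΨ, hΦx, hΨ0, hΦΨ, hΨΦ, hcoord⟩ := exists_straightening hl hlx hi
  have htΨ : Tendsto Ψ (𝓝 0) (𝓝 x) := by simpa [hΨ0] using hΨ.continuousAt.tendsto
  have htΦ : Tendsto Φ (𝓝 x) (𝓝 0) := by simpa [hΦx] using hΦ.continuousAt.tendsto
  obtain ⟨k, u, hk, hu, hu0, hau⟩ := exists_eq_coord_pow_mul (a := fun y => a (Ψ y)) (i := i)
    (contDiffAt_infty_comp (by rwa [hΨ0]) hΨ) (by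
      filter_upwards [htΨ.eventually hz, hΦΨ] with y h1 h2
      rw [h1, ← hcoord, h2])
  obtain ⟨v, hv, hv0, hvu⟩ := exists_root_of_ne_zero hu hu0 hk
  have hvΦ : ContDiffAt ℂ ∞ (fun y => v (Φ y)) x := contDiffAt_infty_comp (by rwa [hΦx]) hΦ
  refine ⟨k, fun y => l y * v (Φ y), hk, hl.mul hvΦ, by simp [hlx], ?_, ?_⟩
  · rw [pd_mul hl hvΦ, hlx, zero_mul, add_zero, hΦx]
    exact mul_ne_zero hi hv0
  · filter_upwards [hΨΦ, htΦ.eventually hau, htΦ.eventually hvu] with y h1 h2 h3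
    rw [h1] at h2
    rw [h2, mul_pow, h3, hcoord]

theorem exists_pow_eq_of_ne_zero_on_ball {p : ℂ → ℂ} {ρ : ℝ} (hρ : 0 < ρ)
    (hp : DifferentiableOn ℂ p (Metric.ball 0 ρ)) (hne : ∀ ζ ∈ Metric.ball (0 : ℂ) ρ, p ζ ≠ 0)
    {m : ℕ} (hm : m ≠ 0) :
    ∃ h : ℂ → ℂ, DifferentiableOn ℂ h (Metric.ball 0 ρ) ∧
      ∀ ζ ∈ Metric.ball (0 : ℂ) ρ, h ζ ^ m = p ζ := by
  have h0 : (0 : ℂ) ∈ Metric.ball (0 : ℂ) ρ := Metric.mem_ball_self hρ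
  obtain ⟨L, hL0, hL⟩ := ((hp.deriv Metric.isOpen_ball).div hp hne).isExactOn_ball.with_val_at 0
    (Complex.log (p 0))
  have hder : ∀ ζ ∈ Metric.ball (0 : ℂ) ρ,
      HasDerivAt (fun ζ => p ζ * Complex.exp (-L ζ)) 0 ζ := by
    intro ζ hζ
    have h1 := (hp.differentiableAt (Metric.isOpen_ball.mem_nhds hζ)).hasDerivAt
    convert! h1.mul (hL ζ hζ).neg.cexp using 1
    simp only [Pi.div_apply]
    field_simp [hne ζ hζ]
    ring
  have hconst : ∀ ζ ∈ Metric.ball (0 : ℂ) ρ, p ζ = Complex.exp (L ζ) := by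
    intro ζ hζ
    have h1 := Metric.isOpen_ball.is_const_of_deriv_eq_zero
      (convex_ball (0 : ℂ) ρ).isPreconnected
      (fun w hw => (hder w hw).differentiableAt.differentiableWithinAt)
      (fun w hw => (hder w hw).deriv) hζ h0
    simp only [hL0, Complex.exp_neg, Complex.exp_log (hne 0 h0)] at h1
    rw [mul_inv_cancel₀ (hne 0 h0), mul_inv_eq_one₀ (Complex.exp_ne_zero _)] at h1
    exact h1
  refine ⟨fun ζ => Complex.exp (L ζ / m), fun ζ hζ => ?_, fun ζ hζ => ?_⟩
  · exact ((hL ζ hζ).div_const _).cexp.differentiableAt.differentiableWithinAt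
  · rw [← Complex.exp_nat_mul, mul_div_cancel₀ _ (Nat.cast_ne_zero.2 hm), hconst ζ hζ]

/-- A holomorphic function on a disc with finitely many zeros and local `m`-th roots has a global
`m`-th root. -/
theorem exists_pow_eq_on_ball {ρ : ℝ} (hρ : 0 < ρ) {m : ℕ} (hm : m ≠ 0) (Z : Finset ℂ) :
    ∀ p : ℂ → ℂ, DifferentiableOn ℂ p (Metric.ball 0 ρ) →
      (∀ ζ ∈ Metric.ball (0 : ℂ) ρ, p ζ = 0 → ζ ∈ Z) →
      (∀ ζ ∈ Metric.ball (0 : ℂ) ρ, ∃ h : ℂ → ℂ, AnalyticAt ℂ h ζ ∧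
        ∀ᶠ w in 𝓝 ζ, h w ^ m = p w) →
      ∃ h : ℂ → ℂ, DifferentiableOn ℂ h (Metric.ball 0 ρ) ∧
        ∀ ζ ∈ Metric.ball (0 : ℂ) ρ, h ζ ^ m = p ζ := by
  classical
  induction Z using Finset.induction_on with
  | empty =>
    intro p hp hZ _
    exact exists_pow_eq_of_ne_zero_on_ball hρ hp (fun ζ hζ h => by simpa using hZ ζ hζ h) hm
  | insert z Z hzZ ih =>
    intro p hp hZ hloc
    by_cases hz : z ∈ Metric.ball (0 : ℂ) ρ
    swap
    · refine ih p hp (fun ζ hζ h => ?_) hloc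
      exact Finset.mem_of_mem_insert_of_ne (hZ ζ hζ h) (fun h' => hz (h' ▸ hζ))
    obtain ⟨h, hh, hhp⟩ := hloc z hz
    have hev : ¬ ∀ᶠ w in 𝓝 z, h w = 0 := by
      intro hcon
      have h1 : ∀ᶠ w in 𝓝[≠] z, w ∉ insert z Z := by
        have : ∀ᶠ w in 𝓝 z, w ∉ Z := Z.finite_toSet.isClosed.isOpen_compl.mem_nhds hzZ
        filter_upwards [this.filter_mono nhdsWithin_le_nhds, eventually_mem_nhdsWithin]
          with w h1 h2
        rw [Finset.mem_insert, not_or]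
        exact ⟨h2, h1⟩
      obtain ⟨w, h1, h2, h3, h4⟩ := (h1.and ((hcon.and (hhp.and
        (Metric.isOpen_ball.mem_nhds hz))).filter_mono nhdsWithin_le_nhds)).exists
      refine h1 (hZ w h4 ?_)
      rw [← h3, h2, zero_pow hm]
    obtain ⟨k, g, hg, hgz, hhg⟩ := hh.exists_eventuallyEq_pow_smul_nonzero_iff.2 hev
    set q : ℂ → ℂ := Function.update (fun w => p w / (w - z) ^ (k * m)) z (g z ^ m) with hq
    have hqz : q =ᶠ[𝓝 z] fun w => g w ^ m := by
      filter_upwards [hhg, hhp] with w h1 h2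
      rcases eq_or_ne w z with rfl | hne
      · simp [hq]
      · have h3 : (w - z) ^ (k * m) ≠ 0 := pow_ne_zero _ (sub_ne_zero.2 hne)
        rw [hq, Function.update_of_ne hne, ← h2, h1, smul_eq_mul, mul_pow, ← pow_mul,
          mul_div_cancel_left₀ _ h3]
    have hqw : ∀ w, w ≠ z → q w = p w / (w - z) ^ (k * m) := fun w hw => by
      rw [hq, Function.update_of_ne hw]
    have hqe : ∀ w, w ≠ z → q =ᶠ[𝓝 w] fun w => p w / (w - z) ^ (k * m) := fun w hw => by
      filter_upwards [isOpen_ne.mem_nhds hw] with v hv using hqw v hv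
    refine (ih q (fun w hw => ?_) (fun w hw h0 => ?_) fun w hw => ?_).elim fun H hH => ?_
    · refine DifferentiableAt.differentiableWithinAt ?_
      rcases eq_or_ne w z with rfl | hne
      · exact (hg.differentiableAt.pow m).congr_of_eventuallyEq hqz
      · refine DifferentiableAt.congr_of_eventuallyEq ?_ (hqe w hne)
        exact (hp.differentiableAt (Metric.isOpen_ball.mem_nhds hw)).div (by fun_prop)
          (pow_ne_zero _ (sub_ne_zero.2 hne))
    · rcases eq_or_ne w z with rfl | hne
      · rw [hqz.self_of_nhds] at h0
        exact absurd h0 (pow_ne_zero _ hgz)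
      · rw [hqw w hne, div_eq_zero_iff, or_iff_left (pow_ne_zero _ (sub_ne_zero.2 hne))] at h0
        exact Finset.mem_of_mem_insert_of_ne (hZ w hw h0) hne
    · rcases eq_or_ne w z with rfl | hne
      · exact ⟨g, hg, hqz.symm⟩
      · obtain ⟨f, hf, hfp⟩ := hloc w hw
        refine ⟨fun v => f v / (v - z) ^ k,
          hf.fun_div (by fun_prop) (pow_ne_zero _ (sub_ne_zero.2 hne)), ?_⟩
        filter_upwards [hqe w hne, hfp] with v h1 h2
        rw [h1, div_pow, h2, ← pow_mul]
    · obtain ⟨hH, hHq⟩ := hH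
      refine ⟨fun w => (w - z) ^ k * H w, ?_, fun w hw => ?_⟩
      · exact (DifferentiableOn.pow (by fun_prop) _).mul hH
      · rw [mul_pow, hHq w hw, ← pow_mul]
        rcases eq_or_ne w z with rfl | hne
        · rw [hqz.self_of_nhds, ← hhp.self_of_nhds, hhg.self_of_nhds, smul_eq_mul, mul_pow,
            ← pow_mul]
        · rw [hqw w hne, mul_div_cancel₀ _ (pow_ne_zero _ (sub_ne_zero.2 hne))]

theorem exists_pow_eq_on_smaller_ball {p : ℂ → ℂ} {ρ' ρ : ℝ} (hρ' : 0 < ρ') (hρ : ρ' < ρ)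
    (hp : AnalyticOnNhd ℂ p (Metric.ball 0 ρ)) (hne : ∃ ζ ∈ Metric.ball (0 : ℂ) ρ, p ζ ≠ 0)
    {m : ℕ} (hm : m ≠ 0)
    (hloc : ∀ ζ ∈ Metric.ball (0 : ℂ) ρ, ∃ h : ℂ → ℂ, AnalyticAt ℂ h ζ ∧
      ∀ᶠ w in 𝓝 ζ, h w ^ m = p w) :
    ∃ h : ℂ → ℂ, DifferentiableOn ℂ h (Metric.ball 0 ρ') ∧
      ∀ ζ ∈ Metric.ball (0 : ℂ) ρ', h ζ ^ m = p ζ := by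
  have hsub : Metric.closedBall (0 : ℂ) ρ' ⊆ Metric.ball 0 ρ := Metric.closedBall_subset_ball hρ
  have hsub' : Metric.ball (0 : ℂ) ρ' ⊆ Metric.ball 0 ρ := Metric.ball_subset_ball hρ.le
  have hfin : {ζ ∈ Metric.closedBall (0 : ℂ) ρ' | p ζ = 0}.Finite := by
    by_contra hinf
    obtain ⟨a, ha, hacc⟩ := Set.Infinite.exists_accPt_of_subset_isCompact hinf
      (isCompact_closedBall (0 : ℂ) ρ') (fun ζ hζ => hζ.1)
    obtain ⟨ζ, hζ, hpζ⟩ := hne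
    refine hpζ (hp.eqOn_zero_of_preconnected_of_frequently_eq_zero
      (convex_ball (0 : ℂ) ρ).isPreconnected (hsub ha) ?_ hζ)
    exact (accPt_iff_frequently_nhdsNE.1 hacc).mono fun w hw => hw.2
  refine exists_pow_eq_on_ball hρ' hm hfin.toFinset p (hp.differentiableOn.mono hsub')
    (fun ζ hζ h0 => ?_) (fun ζ hζ => hloc ζ (hsub' hζ))
  simpa [h0] using (mem_closedBall_zero_iff.1 (Metric.ball_subset_closedBall hζ))

/-- Two continuous `m`-th roots on a circle agree up to a constant factor, hence so do their Cauchy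
integrals. -/
theorem circleIntegral_root_pow {h q : ℂ → ℂ} {r ρ : ℝ} (hr : 0 < r) (hρ : r < ρ) {m : ℕ}
    (hm : m ≠ 0) (hh : DifferentiableOn ℂ h (Metric.ball 0 ρ))
    (hq : ContinuousOn q (Metric.sphere 0 r)) (hq0 : ∀ ζ ∈ Metric.sphere (0 : ℂ) r, q ζ ≠ 0)
    (hqh : ∀ ζ ∈ Metric.sphere (0 : ℂ) r, q ζ ^ m = h ζ ^ m) :
    ((2 * Real.pi * Complex.I : ℂ)⁻¹ * ∮ ζ in C(0, r), ζ⁻¹ * q ζ) ^ m = h 0 ^ m := by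
  have hsub : Metric.closedBall (0 : ℂ) r ⊆ Metric.ball 0 ρ := Metric.closedBall_subset_ball hρ
  have hsub' := Metric.sphere_subset_closedBall.trans hsub
  have hcont : ContinuousOn (fun ζ => h ζ / q ζ) (Metric.sphere (0 : ℂ) r) :=
    (hh.continuousOn.mono hsub').div hq hq0
  have hmaps : MapsTo (fun ζ => h ζ / q ζ) (Metric.sphere (0 : ℂ) r) {w : ℂ | w ^ m = 1} := by
    intro ζ hζ
    change (h ζ / q ζ) ^ m = 1
    rw [div_pow, ← hqh ζ hζ, div_self (pow_ne_zero _ (hq0 ζ hζ))]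
  have hfinite : {w : ℂ | w ^ m = 1}.Finite := by
    refine (Polynomial.nthRootsFinset m (1 : ℂ)).finite_toSet.subset fun w hw => ?_
    exact (Polynomial.mem_nthRootsFinset (Nat.pos_of_ne_zero hm) 1).2 hw
  have hpre : IsPreconnected (Metric.sphere (0 : ℂ) r) :=
    isPreconnected_sphere (by simp [Complex.rank_real_complex]) _ _
  obtain ⟨c, hc, heq⟩ := hpre.eqOn_const_of_mapsTo hfinite.isDiscrete hcont hmaps ⟨1, one_pow m⟩
  have hc0 : c ≠ 0 := by
    rintro rfl
    simp [zero_pow hm] at hc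
  have hInt : (∮ ζ in C(0, r), ζ⁻¹ * q ζ) = c⁻¹ * ∮ ζ in C(0, r), (ζ - 0)⁻¹ • h ζ := by
    rw [← smul_eq_mul c⁻¹, ← circleIntegral.integral_smul]
    refine circleIntegral.integral_congr hr.le fun ζ hζ => ?_
    have h1 : h ζ / q ζ = c := heq hζ
    rw [div_eq_iff (hq0 ζ hζ)] at h1
    simp only [sub_zero, smul_eq_mul]
    rw [h1]
    field_simp
  rw [hInt, (hh.diffContOnCl_ball hsub).circleIntegral_sub_inv_smul (Metric.mem_ball_self hr)]
  have hpi : (2 * Real.pi * Complex.I : ℂ) ≠ 0 := Complex.two_pi_I_ne_zero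
  rw [smul_eq_mul, mul_left_comm, inv_mul_cancel_left₀ hpi, mul_pow, inv_pow, hc, inv_one, one_mul]

theorem dense_compl_range_smul {n : ℕ} (hn : 2 ≤ n) (e : Cn n) :
    Dense (range fun ζ : ℂ => ζ • e)ᶜ := by
  have h : ContDiff ℝ 1 (fun ζ : ℂ => ζ • e) := by fun_prop
  refine h.dense_compl_range_of_finrank_lt_finrank ?_
  rw [Module.finrank_pi_fintype]
  simp only [Complex.finrank_real_complex, Finset.sum_const, Finset.card_univ, Fintype.card_fin,
    smul_eq_mul]
  omega

theorem exists_isolated_zero_on_line {n : ℕ} {ψ : Cn n → ℂ} {R : ℝ} (hR : 0 < R)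
    (hψ : ∀ x ∈ Metric.ball (0 : Cn n) R, ContDiffAt ℂ ∞ ψ x) {e : Cn n}
    (he : e ∈ Metric.ball (0 : Cn n) R) (hψe : ψ e ≠ 0) :
    ∀ᶠ ζ : ℂ in 𝓝[≠] 0, ψ (ζ • e) ≠ 0 := by
  have hcont : Continuous fun ζ : ℂ => ζ • e := by fun_prop
  set S : Set ℂ := {ζ | ζ • e ∈ Metric.ball (0 : Cn n) R} with hS
  have hSo : IsOpen S := Metric.isOpen_ball.preimage hcont
  have hSc : Convex ℝ S := by
    have : S = ((LinearMap.toSpanSingleton ℂ (Cn n) e).restrictScalars ℝ) ⁻¹' Metric.ball 0 R := by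
      ext ζ
      simp [hS]
    rw [this]
    exact (convex_ball _ _).linear_preimage _
  have han : AnalyticOnNhd ℂ (fun ζ : ℂ => ψ (ζ • e)) S := by
    refine DifferentiableOn.analyticOnNhd (fun ζ hζ => ?_) hSo
    exact (((hψ _ hζ).differentiableAt (by simp)).comp ζ (f := fun ζ : ℂ => ζ • e)
      (by fun_prop)).differentiableWithinAt
  have h0 : (0 : ℂ) ∈ S := by simpa [hS] using hR
  have h1 : (1 : ℂ) ∈ S := by simpa [hS] using he
  refine (han 0 h0).eventually_eq_zero_or_eventually_ne_zero.resolve_left fun h => hψe ?_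
  simpa using han.eqOn_zero_of_preconnected_of_eventuallyEq_zero hSc.isPreconnected h0 h h1

theorem exists_pow_eq_of_local_roots {n : ℕ} (hn : 2 ≤ n) {ψ : Cn n → ℂ}
    (hψ : ContDiffAt ℂ ∞ ψ 0) (hne : ∃ᶠ x in 𝓝 0, ψ x ≠ 0) {m : ℕ} (hm : m ≠ 0)
    (hloc : ∀ᶠ x in 𝓝 (0 : Cn n), x ≠ 0 → ∃ f : Cn n → ℂ, ContDiffAt ℂ ∞ f x ∧
      ∀ᶠ y in 𝓝 x, f y ^ m = ψ y) :
    ∃ f : Cn n → ℂ, ContDiffAt ℂ ∞ f 0 ∧ ∀ᶠ x in 𝓝 0, f x ^ m = ψ x := by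
  obtain ⟨R, hR, hball⟩ := Metric.eventually_nhds_iff_ball.1 (hψ.eventually_infty.and hloc)
  obtain ⟨e, hψe, he⟩ := (hne.and_eventually (Metric.ball_mem_nhds (0 : Cn n) hR)).exists
  have hψR : ∀ x ∈ Metric.ball (0 : Cn n) R, ContDiffAt ℂ ∞ ψ x := fun x hx => (hball x hx).1
  obtain ⟨ρ, hρ, hρe, hρψ⟩ : ∃ ρ > 0, (∀ ζ : ℂ, ‖ζ‖ < ρ → ‖ζ • e‖ < R / 2) ∧
      ∀ ζ : ℂ, ‖ζ‖ < ρ → ζ ≠ 0 → ψ (ζ • e) ≠ 0 := by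
    have h1 := eventually_nhdsWithin_iff.1 (exists_isolated_zero_on_line hR hψR he hψe)
    have h2 : ∀ᶠ ζ : ℂ in 𝓝 0, ‖ζ • e‖ < R / 2 :=
      (ContinuousAt.tendsto (f := fun ζ : ℂ => ‖ζ • e‖) (by fun_prop)).eventually
        (gt_mem_nhds (by simpa using hR))
    obtain ⟨ρ, hρ, h⟩ := Metric.eventually_nhds_iff_ball.1 (h1.and h2)
    exact ⟨ρ, hρ, fun ζ hζ => (h ζ (by simpa using hζ)).2,
      fun ζ hζ h0 => (h ζ (by simpa using hζ)).1 h0⟩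
  set r := ρ / 2 with hr
  have hr0 : 0 < r := half_pos hρ
  have hrρ : r < ρ := half_lt_self hρ
  have hmem : ∀ x : Cn n, ‖x‖ < R / 2 → ∀ ζ : ℂ, ‖ζ‖ < ρ →
      x + ζ • e ∈ Metric.ball (0 : Cn n) R := by
    intro x hx ζ hζ
    rw [mem_ball_zero_iff]
    linarith [norm_add_le x (ζ • e), hρe ζ hζ]
  have hsph : ∀ ζ ∈ Metric.sphere (0 : ℂ) r, ‖ζ‖ < ρ ∧ ζ ≠ 0 := by
    intro ζ hζ
    rw [mem_sphere_zero_iff_norm] at hζ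
    refine ⟨hζ.trans_lt hrρ, ?_⟩
    rintro rfl
    simp at hζ
    exact hr0.ne hζ
  have hcont : ∀ x : Cn n, ‖x‖ < R / 2 → ∀ ζ : ℂ, ‖ζ‖ < ρ →
      ContinuousAt (fun q : Cn n × ℂ => ψ (q.1 + q.2 • e)) (x, ζ) := by
    intro x hx ζ hζ
    have h2 : ContinuousAt (fun q : Cn n × ℂ => q.1 + q.2 • e) (x, ζ) := by fun_prop
    exact ContinuousAt.comp (f := fun q : Cn n × ℂ => q.1 + q.2 • e)
      (hψR _ (hmem x hx ζ hζ)).continuousAt h2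
  have hR2 : ‖(0 : Cn n)‖ < R / 2 := by simpa using hR
  obtain ⟨δ, hδ, hδK⟩ := exists_pos_forall_lt_of_isCompact (K := Metric.sphere (0 : ℂ) r)
    (f := fun ζ => ‖ψ (0 + ζ • e)‖) (isCompact_sphere _ _)
    (fun ζ hζ => by
      have h1 := hcont 0 hR2 ζ (hsph ζ hζ).1
      have h2 : ContinuousAt (fun ζ : ℂ => ((0 : Cn n), ζ)) ζ := by fun_prop
      exact (ContinuousAt.comp (f := fun ζ : ℂ => ((0 : Cn n), ζ)) h1 h2).norm.continuousWithinAt)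
    (fun ζ hζ => norm_pos_iff.2 (by
      rw [zero_add]; exact hρψ ζ (hsph ζ hζ).1 (hsph ζ hζ).2))
  have hnear : ∀ᶠ x in 𝓝 (0 : Cn n), ∀ ζ ∈ Metric.sphere (0 : ℂ) r,
      ‖ψ (x + ζ • e) - ψ (0 + ζ • e)‖ < δ / 4 := by
    refine (isCompact_sphere _ _).eventually_forall_of_forall_eventually fun ζ hζ => ?_
    have h1 := hcont 0 hR2 ζ (hsph ζ hζ).1
    have h2 : ContinuousAt (fun q : Cn n × ℂ => ((0 : Cn n), q.2)) (0, ζ) := by fun_prop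
    have h3 : ContinuousAt (fun q : Cn n × ℂ => ψ (0 + q.2 • e)) (0, ζ) :=
      ContinuousAt.comp (g := fun q : Cn n × ℂ => ψ (q.1 + q.2 • e))
        (f := fun q : Cn n × ℂ => ((0 : Cn n), q.2)) h1 h2
    exact (h1.sub h3).norm.eventually (gt_mem_nhds (by simpa using hδ))
  obtain ⟨ε, hε, hεball⟩ := Metric.eventually_nhds_iff_ball.1
    (hnear.and (Metric.ball_mem_nhds (0 : Cn n) (half_pos hR)))
  have hεR : ∀ x ∈ Metric.ball (0 : Cn n) ε, ‖x‖ < R / 2 := fun x hx =>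
    mem_ball_zero_iff.1 (hεball x hx).2
  have hεne : ∀ x ∈ Metric.ball (0 : Cn n) ε, ∀ ζ ∈ Metric.sphere (0 : ℂ) r,
      3 * δ / 4 < ‖ψ (x + ζ • e)‖ := by
    intro x hx ζ hζ
    have h1 := (hεball x hx).1 ζ hζ
    have h2 := hδK ζ hζ
    have h3 := norm_sub_norm_le (ψ (0 + ζ • e)) (ψ (x + ζ • e))
    rw [norm_sub_rev] at h3
    linarith
  have hroot : ∀ x ∈ Metric.ball (0 : Cn n) ε, x ∉ range (fun ζ : ℂ => ζ • e) →
      ∃ h : ℂ → ℂ, DifferentiableOn ℂ h (Metric.ball 0 ((r + ρ) / 2)) ∧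
        ∀ ζ ∈ Metric.ball (0 : ℂ) ((r + ρ) / 2), h ζ ^ m = ψ (x + ζ • e) := by
    intro x hx hxe
    have han : AnalyticOnNhd ℂ (fun ζ : ℂ => ψ (x + ζ • e)) (Metric.ball 0 ρ) := by
      refine DifferentiableOn.analyticOnNhd (fun ζ hζ => ?_) Metric.isOpen_ball
      exact (((hψR _ (hmem x (hεR x hx) ζ (mem_ball_zero_iff.1 hζ))).differentiableAt
        (by simp)).comp ζ (f := fun ζ : ℂ => x + ζ • e) (by fun_prop)).differentiableWithinAt
    refine exists_pow_eq_on_smaller_ball (by linarith) (by linarith) han ?_ hm fun ζ hζ => ?_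
    · have hrs : (r : ℂ) ∈ Metric.sphere (0 : ℂ) r := by simp [hr0.le]
      refine ⟨r, by simpa using (hsph _ hrs).1, fun h => ?_⟩
      have := hεne x hx r hrs
      rw [h, norm_zero] at this
      linarith
    · have hne0 : x + ζ • e ≠ 0 := fun h => hxe ⟨-ζ, by
        change -ζ • e = x
        rw [neg_smul, eq_comm, eq_neg_iff_add_eq_zero, h]⟩
      obtain ⟨f, hf, hfψ⟩ := (hball _ (hmem x (hεR x hx) ζ (mem_ball_zero_iff.1 hζ))).2 hne0
      have ht : Tendsto (fun w : ℂ => x + w • e) (𝓝 ζ) (𝓝 (x + ζ • e)) :=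
        Continuous.tendsto (by fun_prop) _
      refine ⟨fun w => f (x + w • e), ?_, ht.eventually hfψ⟩
      rw [Complex.analyticAt_iff_eventually_differentiableAt]
      filter_upwards [ht.eventually hf.eventually_infty] with w hw
      exact (hw.differentiableAt (by simp)).comp w (f := fun w : ℂ => x + w • e) (by fun_prop)
  have hdense := dense_compl_range_smul hn e
  obtain ⟨x₀, hx₀, hx₀e⟩ := hdense.inter_open_nonempty _ Metric.isOpen_ball
    ⟨0, Metric.mem_ball_self (x := (0 : Cn n)) hε⟩
  obtain ⟨h₀, hh₀, hh₀ψ⟩ := hroot x₀ hx₀ hx₀e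
  have hsub : Metric.sphere (0 : ℂ) r ⊆ Metric.ball 0 ((r + ρ) / 2) := fun ζ hζ => by
    rw [mem_sphere_zero_iff_norm] at hζ
    rw [mem_ball_zero_iff, hζ]
    linarith
  have hne₀ : ∀ x ∈ Metric.ball (0 : Cn n) ε, ∀ ζ ∈ Metric.sphere (0 : ℂ) r,
      ψ (x + ζ • e) ≠ 0 := fun x hx ζ hζ => by
    rw [← norm_pos_iff]
    linarith [hεne x hx ζ hζ]
  have hslit : ∀ x ∈ Metric.ball (0 : Cn n) ε, ∀ ζ ∈ Metric.sphere (0 : ℂ) r,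
      ψ (x + ζ • e) / ψ (x₀ + ζ • e) ∈ Complex.slitPlane := by
    intro x hx ζ hζ
    have h0 := hne₀ x₀ hx₀ ζ hζ
    have h1 : ψ (x + ζ • e) / ψ (x₀ + ζ • e)
        = 1 + (ψ (x + ζ • e) - ψ (x₀ + ζ • e)) / ψ (x₀ + ζ • e) := by
      field_simp
      ring
    rw [h1]
    refine Complex.mem_slitPlane_of_norm_lt_one ?_
    rw [norm_div, div_lt_one (norm_pos_iff.2 h0)]
    have h2 := norm_sub_le_norm_sub_add_norm_sub (ψ (x + ζ • e)) (ψ (0 + ζ • e)) (ψ (x₀ + ζ • e))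
    rw [norm_sub_rev (ψ (0 + ζ • e))] at h2
    linarith [(hεball x hx).1 ζ hζ, (hεball x₀ hx₀).1 ζ hζ, hεne x₀ hx₀ ζ hζ]
  set q : Cn n → ℂ → ℂ := fun x ζ =>
    h₀ ζ * Complex.exp (Complex.log (ψ (x + ζ • e) / ψ (x₀ + ζ • e)) / m) with hq
  have hqψ : ∀ x ∈ Metric.ball (0 : Cn n) ε, ∀ ζ ∈ Metric.sphere (0 : ℂ) r,
      q x ζ ^ m = ψ (x + ζ • e) := by
    intro x hx ζ hζ
    rw [hq]
    simp only
    rw [mul_pow, hh₀ψ ζ (hsub hζ), ← Complex.exp_nat_mul,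
      mul_div_cancel₀ _ (Nat.cast_ne_zero.2 hm),
      Complex.exp_log (div_ne_zero (hne₀ x hx ζ hζ) (hne₀ x₀ hx₀ ζ hζ)),
      mul_div_cancel₀ _ (hne₀ x₀ hx₀ ζ hζ)]
  have hψc : ContinuousOn (fun p : Cn n × ℂ => ψ (p.1 + p.2 • e))
      (Metric.ball 0 ε ×ˢ Metric.sphere 0 r) := fun p hp =>
    (hcont p.1 (hεR p.1 hp.1) p.2 (hsph p.2 hp.2).1).continuousWithinAt
  have hqc : ContinuousOn (fun p : Cn n × ℂ => q p.1 p.2)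
      (Metric.ball 0 ε ×ˢ Metric.sphere 0 r) := by
    have h1 : ContinuousOn (fun p : Cn n × ℂ => h₀ p.2) (Metric.ball 0 ε ×ˢ Metric.sphere 0 r) :=
      (hh₀.continuousOn.mono hsub).comp continuousOn_snd fun p hp => hp.2
    have h2 : ContinuousOn (fun p : Cn n × ℂ => ψ (x₀ + p.2 • e))
        (Metric.ball 0 ε ×ˢ Metric.sphere 0 r) :=
      hψc.comp (f := fun p : Cn n × ℂ => (x₀, p.2)) (by fun_prop) fun p hp => ⟨hx₀, hp.2⟩
    refine h1.mul (((hψc.div h2 fun p hp => hne₀ x₀ hx₀ p.2 hp.2).clog fun p hp =>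
      hslit p.1 hp.1 p.2 hp.2).div_const _).cexp
  have hqd : ∀ ζ ∈ Metric.sphere (0 : ℂ) r,
      DifferentiableOn ℂ (fun x => q x ζ) (Metric.ball 0 ε) := by
    intro ζ hζ
    have h1 : DifferentiableOn ℂ (fun x => ψ (x + ζ • e)) (Metric.ball 0 ε) := fun x hx =>
      (((hψR _ (hmem x (hεR x hx) ζ (hsph ζ hζ).1)).differentiableAt (by simp)).comp x
        (f := fun x => x + ζ • e) (by fun_prop)).differentiableWithinAt
    exact ((((h1.mul_const (ψ (x₀ + ζ • e))⁻¹).clog fun x hx => by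
      simpa only [div_eq_mul_inv] using hslit x hx ζ hζ).mul_const (m : ℂ)⁻¹).cexp.const_mul (h₀ ζ))
  set f : Cn n → ℂ := fun x => (2 * Real.pi * Complex.I : ℂ)⁻¹ * ∮ ζ in C(0, r), ζ⁻¹ * q x ζ
    with hf
  have hfd : DifferentiableOn ℂ f (Metric.ball 0 ε) := by
    refine DifferentiableOn.const_mul (differentiableOn_circleIntegral hr0.le Metric.isOpen_ball
      (ContinuousOn.mul (ContinuousOn.inv₀ continuousOn_snd fun p hp => (hsph p.2 hp.2).2) hqc)
      fun ζ hζ => (hqd ζ hζ).const_mul _) _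
  have hfψ : ∀ x ∈ Metric.ball (0 : Cn n) ε, x ∉ range (fun ζ : ℂ => ζ • e) →
      f x ^ m = ψ x := by
    intro x hx hxe
    obtain ⟨h, hh, hhψ⟩ := hroot x hx hxe
    have h0 := hhψ 0 (Metric.mem_ball_self (by linarith))
    rw [zero_smul, add_zero] at h0
    rw [← h0]
    refine circleIntegral_root_pow hr0 (by linarith) hm hh ?_ (fun ζ hζ h0 => ?_) fun ζ hζ => ?_
    · exact hqc.comp (f := fun ζ : ℂ => (x, ζ)) (by fun_prop) fun ζ hζ => ⟨hx, hζ⟩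
    · refine hne₀ x hx ζ hζ ?_
      rw [← hqψ x hx ζ hζ, h0, zero_pow hm]
    · rw [hqψ x hx ζ hζ, hhψ ζ (hsub hζ)]
  refine ⟨f, contDiffOn_infty_of_isOpen Metric.isOpen_ball hfd |>.contDiffAt
    (Metric.ball_mem_nhds 0 hε), ?_⟩
  filter_upwards [Metric.ball_mem_nhds 0 hε] with x hx
  have hclos : x ∈ closure (Metric.ball (0 : Cn n) ε ∩ (range fun ζ : ℂ => ζ • e)ᶜ) :=
    hdense.open_subset_closure_inter Metric.isOpen_ball hx
  have h1 : ContinuousAt (fun x => f x ^ m - ψ x) x :=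
    ((hfd.continuousOn.continuousAt (Metric.isOpen_ball.mem_nhds hx)).pow m).sub
      (hψR x (by
        have := hεR x hx
        rw [mem_ball_zero_iff]
        linarith)).continuousAt
  by_contra hcon
  obtain ⟨y, hy1, hy2, hy3⟩ := mem_closure_iff_nhds.1 hclos _
    (h1.eventually_ne (sub_ne_zero.2 hcon))
  exact hy1 (sub_eq_zero.2 (hfψ y hy2 hy3))

/-- Near `x` the function `ψ` is the `m`-th power of a submersive holomorphic function vanishing
at `x`. -/
def IsSubmersivePowerAt {n : ℕ} (ψ : Cn n → ℂ) (m : ℕ) (x : Cn n) : Prop :=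
  ∃ (f : Cn n → ℂ) (i : Fin n), ContDiffAt ℂ ∞ f x ∧ f x = 0 ∧ pd i f x ≠ 0 ∧
    ∀ᶠ y in 𝓝 x, f y ^ m = ψ y

theorem IsSubmersivePowerAt.eventually {n : ℕ} {ψ : Cn n → ℂ} {m : ℕ} {x : Cn n}
    (h : IsSubmersivePowerAt ψ m x) :
    ∀ᶠ y in 𝓝 x, ψ y = 0 → IsSubmersivePowerAt ψ m y := by
  obtain ⟨f, i, hf, hfx, hi, hψ⟩ := h
  filter_upwards [hf.eventually_infty, (contDiffAt_pd hf i).continuousAt.eventually_ne hi,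
    eventually_eventually_nhds.2 hψ] with y h1 h2 h3 h4
  exact ⟨f, i, h1, eq_zero_of_pow_eq_zero (h3.self_of_nhds.trans h4), h2, h3⟩

theorem IsSubmersivePowerAt.le {n : ℕ} {ψ : Cn n → ℂ} {m m' : ℕ} {x : Cn n}
    (h : IsSubmersivePowerAt ψ m x) (h' : IsSubmersivePowerAt ψ m' x) : m' ≤ m := by
  obtain ⟨f, i, hf, hfx, hi, hψ⟩ := h
  obtain ⟨f', i', hf', hfx', hi', hψ'⟩ := h'
  set e : Cn n := Pi.single i 1 with he
  have h1 : analyticOrderAt (fun ζ : ℂ => f (x + ζ • e)) 0 = 1 := by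
    refine (hf.analyticAt_comp_line e).analyticOrderAt_eq_one_of_zero_deriv_ne_zero
      (by simpa using hfx) ?_
    rwa [(hf.hasDerivAt_pd i).deriv]
  have h2 : 1 ≤ analyticOrderAt (fun ζ : ℂ => f' (x + ζ • e)) 0 := by
    rw [Order.one_le_iff_ne_zero, (hf'.analyticAt_comp_line e).analyticOrderAt_ne_zero]
    simpa using hfx'
  have h3 := analyticOrderAt_pow (hf.analyticAt_comp_line e) m
  have h4 := analyticOrderAt_pow (hf'.analyticAt_comp_line e) m'
  have ht : Tendsto (fun ζ : ℂ => x + ζ • e) (𝓝 0) (𝓝 x) :=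
    Continuous.tendsto' (by fun_prop) _ _ (by simp)
  have h5 : (fun ζ : ℂ => f (x + ζ • e)) ^ m =ᶠ[𝓝 0] (fun ζ : ℂ => f' (x + ζ • e)) ^ m' := by
    filter_upwards [ht.eventually hψ, ht.eventually hψ'] with ζ h6 h7
    simp only [Pi.pow_apply]
    rw [h6, h7]
  rw [analyticOrderAt_congr h5, h4, h1] at h3
  have h6 : (m' : ℕ∞) ≤ m := by
    calc (m' : ℕ∞) = m' • (1 : ℕ∞) := by simp
      _ ≤ m' • analyticOrderAt (fun ζ : ℂ => f' (x + ζ • e)) 0 := nsmul_le_nsmul_right h2 m'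
      _ = m := by rw [h3]; simp
  exact_mod_cast h6

theorem IsSubmersivePowerAt.unique {n : ℕ} {ψ : Cn n → ℂ} {m m' : ℕ} {x : Cn n}
    (h : IsSubmersivePowerAt ψ m x) (h' : IsSubmersivePowerAt ψ m' x) : m = m' :=
  le_antisymm (h'.le h) (h.le h')

theorem isPreconnected_punctured_ball_hyperplane {n : ℕ} (hn : 2 ≤ n) (i : Fin n) {r : ℝ}
    (hr : 0 < r) : IsPreconnected {y : Cn n | ‖y‖ < r ∧ y i = 0 ∧ y ≠ 0} := by
  set E : Submodule ℝ (Cn n) := (LinearMap.ker (LinearMap.proj i : Cn n →ₗ[ℂ] ℂ)).restrictScalars ℝ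
    with hE
  have hmemE : ∀ y : Cn n, y ∈ E ↔ y i = 0 := fun y => by simp [hE]
  have hrank : 1 < Module.rank ℝ E := by
    have : Nontrivial (Fin n) := Fin.nontrivial_iff_two_le.2 hn
    obtain ⟨j, hj⟩ := exists_ne i
    refine Module.one_lt_rank_of_one_lt_finrank ?_
    have hv : ∀ c : ℂ, Pi.single j c ∈ E := fun c => by
      rw [hmemE, Pi.single_eq_of_ne hj.symm]
    have hinj : Function.Injective
        (((LinearMap.single ℝ (fun _ : Fin n => ℂ) j)).codRestrict E hv) := by
      intro a b hab
      have h : (Pi.single j a : Cn n) j = (Pi.single j b : Cn n) j :=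
        congrFun (congrArg Subtype.val hab) j
      simpa using h
    have := LinearMap.finrank_le_finrank_of_injective hinj
    rw [Complex.finrank_real_complex] at this
    omega
  have himage : {y : Cn n | ‖y‖ < r ∧ y i = 0 ∧ y ≠ 0}
      = (fun z : E => (r / (1 + ‖z‖)) • (z : Cn n)) '' {0}ᶜ := by
    ext y
    constructor
    · rintro ⟨h1, h2, h3⟩
      have h4 : 0 < r - ‖y‖ := sub_pos.2 h1
      refine ⟨⟨(r - ‖y‖)⁻¹ • y, E.smul_mem _ ((hmemE y).2 h2)⟩, ?_, ?_⟩
      · simp [h3, h4.ne']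
      · simp only [Submodule.coe_norm, norm_smul, norm_inv, Real.norm_of_nonneg h4.le, smul_smul]
        have : r / (1 + (r - ‖y‖)⁻¹ * ‖y‖) * (r - ‖y‖)⁻¹ = 1 := by
          have h5 : 1 + (r - ‖y‖)⁻¹ * ‖y‖ = r * (r - ‖y‖)⁻¹ := by
            field_simp
            ring
          rw [h5]
          field_simp
        rw [this, one_smul]
    · rintro ⟨z, hz, rfl⟩
      have hz0 : z ≠ 0 := hz
      have h1 : 0 < 1 + ‖z‖ := by positivity
      have hc : 0 < r / (1 + ‖z‖) := div_pos hr h1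
      refine ⟨?_, ?_, ?_⟩
      · rw [norm_smul, Real.norm_of_nonneg hc.le, ← Submodule.coe_norm, div_mul_eq_mul_div,
          div_lt_iff₀ h1]
        nlinarith
      · simp [(hmemE z).1 z.2]
      · exact smul_ne_zero hc.ne' (by simpa using hz0)
  rw [himage]
  refine (isConnected_compl_singleton_of_one_lt_rank hrank 0).isPreconnected.image _
    (Continuous.continuousOn ?_)
  have h1 : Continuous fun z : E => r / (1 + ‖z‖) :=
    continuous_const.div (continuous_const.add continuous_norm) fun z => by positivity
  exact h1.smul continuous_subtype_val

theorem exists_uniform_multiplicity {n : ℕ} (hn : 2 ≤ n) {g : Cn n → Cn n}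
    (hg : ContDiffAt ℂ ∞ g 0) (hg0 : g 0 = 0) (hiso : ∀ᶠ y in 𝓝 0, g y = 0 → y = 0)
    {φ : Cn n → ℂ} (hφ : ContDiffAt ℂ ∞ φ 0) (hφ0 : φ 0 = 0) {i : Fin n} (hi : pd i φ 0 ≠ 0)
    {ψ : Cn n → ℂ} (hz : ∀ᶠ y in 𝓝 0, ψ (g y) = 0 ↔ φ y = 0)
    (hloc : ∀ᶠ x in 𝓝 0, x ≠ 0 → ψ x = 0 → ∃ m ≠ 0, IsSubmersivePowerAt ψ m x) :
    ∃ m ≠ 0, ∀ᶠ x in 𝓝 0, x ≠ 0 → ψ x = 0 → IsSubmersivePowerAt ψ m x := by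
  obtain ⟨Φ, Ψ, hΦ, hΨ, hΦ0, hΨ0, hΦΨ, hΨΦ, hcoord⟩ := exists_straightening hφ hφ0 hi
  have htΨ : Tendsto Ψ (𝓝 0) (𝓝 0) := by simpa [hΨ0] using hΨ.continuousAt.tendsto
  have htΦ : Tendsto Φ (𝓝 0) (𝓝 0) := by simpa [hΦ0] using hΦ.continuousAt.tendsto
  have htg : Tendsto g (𝓝 0) (𝓝 0) := by simpa [hg0] using hg.continuousAt.tendsto
  have hev : ∀ᶠ y in 𝓝 (0 : Cn n), ContinuousAt (fun y => g (Ψ y)) y ∧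
      (y ≠ 0 → g (Ψ y) ≠ 0) ∧ (y i = 0 → ψ (g (Ψ y)) = 0) ∧
      (g (Ψ y) ≠ 0 → ψ (g (Ψ y)) = 0 → ∃ m ≠ 0, IsSubmersivePowerAt ψ m (g (Ψ y))) := by
    filter_upwards [hΨ.eventually_infty_pi, htΨ.eventually hg.eventually_infty_pi,
      htΨ.eventually hiso, htΨ.eventually hz, hΦΨ, (htg.comp htΨ).eventually hloc]
      with y h1 h2 h3 h4 h5 h6
    refine ⟨ContinuousAt.comp (g := g) h2.continuousAt h1.continuousAt, fun hy h => hy ?_,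
      fun hy => ?_, h6⟩
    · rw [← h5, h3 h, hΦ0]
    · rw [h4, ← hcoord, h5, hy]
  obtain ⟨r, hr, hball⟩ := Metric.eventually_nhds_iff_ball.1 hev
  set H : Set (Cn n) := {y | ‖y‖ < r ∧ y i = 0 ∧ y ≠ 0} with hH
  have hHball : ∀ y ∈ H, ContinuousAt (fun y => g (Ψ y)) y ∧ ψ (g (Ψ y)) = 0 ∧
      ∃ m ≠ 0, IsSubmersivePowerAt ψ m (g (Ψ y)) := by
    rintro y ⟨h1, h2, h3⟩
    obtain ⟨h4, h5, h6, h7⟩ := hball y (mem_ball_zero_iff.2 h1)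
    exact ⟨h4, h6 h2, h7 (h5 h3) (h6 h2)⟩
  choose! M hM0 hM using fun y hy => (hHball y hy).2.2
  have hMc : ContinuousOn M H := by
    intro y hy
    have h1 : ∀ᶠ y' in 𝓝[H] y, M y' = M y := by
      filter_upwards [((hHball y hy).1.eventually (hM y hy).eventually).filter_mono
        nhdsWithin_le_nhds, eventually_mem_nhdsWithin] with y' h2 h3
      exact (hM y' h3).unique (h2 (hHball y' h3).2.1)
    exact (continuousWithinAt_const (b := M y)).congr_of_eventuallyEq h1 rfl
  obtain ⟨m, hm, hMm⟩ := (isPreconnected_punctured_ball_hyperplane hn i hr).eqOn_const_of_mapsTo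
    (T := {m : ℕ | m ≠ 0}) DiscreteTopology.isDiscrete hMc hM0 ⟨1, one_ne_zero⟩
  refine ⟨m, hm, ?_⟩
  filter_upwards [eventually_exists_eq_of_isolated_zero hg hg0 hiso
    ((hΨΦ.and hz).and (htΦ.eventually (Metric.ball_mem_nhds 0 hr)))] with x hx hx0 hψx
  obtain ⟨y, ⟨⟨h1, h2⟩, h3⟩, h4⟩ := hx
  have hyH : Φ y ∈ H := by
    refine ⟨mem_ball_zero_iff.1 h3, ?_, fun h => hx0 ?_⟩
    · rw [hcoord, ← h2, h4, hψx]
    · rw [← h4, ← h1, h, hΨ0, hg0]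
  have h5 := hM _ hyH
  rw [hMm hyH, h1, h4] at h5
  exact h5

theorem not_singular_of_preimage {n : ℕ} (hn : 2 ≤ n) {g : Cn n → Cn n}
    (hg : ContDiffAt ℂ ∞ g 0) (hg0 : g 0 = 0) (hiso : ∀ᶠ y in 𝓝 0, g y = 0 → y = 0)
    {φ : Cn n → ℂ} (hφ : ContDiffAt ℂ ∞ φ 0) (hφ0 : φ 0 = 0) {i : Fin n} (hi : pd i φ 0 ≠ 0)
    {ψ : Cn n → ℂ} (hψ : ContDiffAt ℂ ∞ ψ 0) (hne : ∃ᶠ x in 𝓝 0, ψ x ≠ 0)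
    (hz : ∀ᶠ y in 𝓝 0, ψ (g y) = 0 ↔ φ y = 0)
    (hloc : ∀ᶠ x in 𝓝 0, x ≠ 0 → ψ x = 0 → ∃ m ≠ 0, IsSubmersivePowerAt ψ m x) :
    ∃ m ≠ 0, IsSubmersivePowerAt ψ m 0 := by
  obtain ⟨m, hm, hmloc⟩ := exists_uniform_multiplicity hn hg hg0 hiso hφ hφ0 hi hz hloc
  have htg : Tendsto g (𝓝 0) (𝓝 0) := by simpa [hg0] using hg.continuousAt.tendsto
  obtain ⟨f, hf, hfψ⟩ := exists_pow_eq_of_local_roots hn hψ hne hm (by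
    filter_upwards [hmloc, hψ.eventually_infty] with x h1 h2 h3
    by_cases h4 : ψ x = 0
    · obtain ⟨f, _, hf, _, _, hfψ⟩ := h1 h3 h4
      exact ⟨f, hf, hfψ⟩
    · obtain ⟨v, hv, _, hvψ⟩ := exists_root_of_ne_zero h2 h4 hm
      exact ⟨v, hv, hvψ⟩)
  by_contra! hno
  have hf0 : f 0 = 0 := by
    refine eq_zero_of_pow_eq_zero (n := m) ?_
    have h1 := hz.self_of_nhds
    rw [hg0] at h1
    rw [hfψ.self_of_nhds, h1.2 hφ0]
  have hdf0 : ∀ l, pd l f 0 = 0 := fun l => by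
    by_contra hl
    exact hno m hm ⟨f, l, hf, hf0, hl, hfψ⟩
  have hfiso : ∀ᶠ x in 𝓝 0, f x = 0 → (∀ l, pd l f x = 0) → x = 0 := by
    filter_upwards [hmloc, hf.eventually_infty, eventually_eventually_nhds.2 hfψ]
      with x h1 h2 h3 h4 h5
    by_contra hx
    have hpow := h1 hx (by rw [← h3.self_of_nhds, h4, zero_pow hm])
    obtain ⟨f₁, j, hf₁, hf₁x, hj, hf₁ψ⟩ := id hpow
    obtain ⟨k, s, hk, hs, hsx, hsj, hfs⟩ := exists_eq_pow_of_zeros h2 hf₁ hf₁x hj (by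
      filter_upwards [h3, hf₁ψ] with y h6 h7
      rw [← pow_eq_zero_iff hm, h6, ← h7, pow_eq_zero_iff hm])
    have hkm : IsSubmersivePowerAt ψ (k * m) x := ⟨s, j, hs, hsx, hsj, by
      filter_upwards [h3, hfs] with y h6 h7
      rw [← h6, h7, pow_mul]⟩
    have hk1 : k = 1 := Nat.eq_of_mul_eq_mul_right (Nat.pos_of_ne_zero hm)
      ((hkm.unique hpow).trans (one_mul m).symm)
    refine hsj ?_
    rw [← pd_congr (f := f) (hfs.mono fun y h => by rw [h, hk1, pow_one]) j, h5 j]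
  have hzF : ∀ᶠ y in 𝓝 0, f (g y) = 0 ↔ φ y = 0 := by
    filter_upwards [hz, htg.eventually hfψ] with y h1 h2
    rw [← h1, ← h2, pow_eq_zero_iff hm]
  obtain ⟨k, s, hk, hs, hs0, hsi, hFs⟩ := exists_eq_pow_of_zeros (a := fun y => f (g y))
    (contDiffAt_infty_comp (by rwa [hg0]) hg) hφ hφ0 hi hzF
  obtain ⟨Φ, Ψ, hΦ, hΨ, hΦ0, hΨ0, hΦΨ, hΨΦ, hcoord⟩ := exists_straightening hs hs0 hsi
  have htΨ : Tendsto Ψ (𝓝 0) (𝓝 0) := by simpa [hΨ0] using hΨ.continuousAt.tendsto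
  have : Nontrivial (Fin n) := Fin.nontrivial_iff_two_le.2 hn
  obtain ⟨j, hj⟩ := exists_ne i
  refine not_comp_eventuallyEq_coord_pow hj.symm hk (g := fun y => g (Ψ y)) (f := f) ?_
    (by rw [hΨ0, hg0]) ?_ hf hdf0 hfiso ?_
  · exact ContDiffAt.comp (g := g) 0 (by rwa [hΨ0]) hΨ
  · filter_upwards [htΨ.eventually hiso, hΦΨ] with y h1 h2 h3
    rw [← h2, h1 h3, hΦ0]
  · filter_upwards [htΨ.eventually hFs, hΦΨ] with y h1 h2
    rw [h1, ← hcoord, h2]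

theorem IsSubmersivePowerAt.exists_analyticAt {n : ℕ} {ψ : Cn n → ℂ} {m : ℕ} {x : Cn n}
    (h : IsSubmersivePowerAt ψ m x) (hm : m ≠ 0) (hψ : AnalyticAt ℂ ψ x) :
    ∃ φ : Cn n → ℂ, AnalyticAt ℂ φ x ∧ fderiv ℂ φ x ≠ 0 ∧ ∀ᶠ y in 𝓝 x, φ y = 0 ↔ ψ y = 0 := by
  obtain ⟨f, i, hf, hfx, hi, hfψ⟩ := h
  have key : ∀ j < m, ∃ D w : Cn n → ℂ, AnalyticAt ℂ D x ∧ ContDiffAt ℂ ∞ w x ∧ w x ≠ 0 ∧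
      ∀ᶠ y in 𝓝 x, D y = f y ^ (m - j) * w y := by
    intro j
    induction j with
    | zero =>
      intro _
      exact ⟨ψ, fun _ => 1, hψ, contDiffAt_const, one_ne_zero, hfψ.mono fun y h => by simp [h]⟩
    | succ j ih =>
      intro hj
      obtain ⟨D, w, hD, hw, hwx, hDw⟩ := ih (by omega)
      obtain ⟨k, hk⟩ : ∃ k, m - j = k + 1 := ⟨m - (j + 1), by omega⟩
      have hk' : m - (j + 1) = k := by omega
      rw [hk] at hDw
      rw [hk']
      refine ⟨pd i D, fun y => (k + 1) * pd i f y * w y + f y * pd i w y, ?_, ?_, ?_, ?_⟩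
      · exact ((ContinuousLinearMap.apply ℂ ℂ (Pi.single i 1 : Cn n)).analyticAt _).comp hD.fderiv
      · exact ((contDiffAt_const.mul (contDiffAt_pd hf i)).mul hw).add
          (hf.mul (contDiffAt_pd hw i))
      · simp only [hfx, zero_mul, add_zero]
        exact mul_ne_zero (mul_ne_zero (Nat.cast_add_one_ne_zero k) hi) hwx
      · filter_upwards [eventually_eventually_nhds.2 hDw, hf.eventually_infty,
          hw.eventually_infty] with y h1 h2 h3
        rw [pd_congr h1 i]
        refine pd_eq_of_hasDerivAt ((h2.pow _).mul h3) ?_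
        convert! ((h2.hasDerivAt_pd i).pow (k + 1)).mul (h3.hasDerivAt_pd i) using 1
        simp
        ring
  obtain ⟨D, w, hD, hw, hwx, hDw⟩ := key (m - 1) (by omega)
  rw [show m - (m - 1) = 1 by omega] at hDw
  simp only [pow_one] at hDw
  refine ⟨D, hD, fderiv_ne_zero_of_pd_ne_zero (i := i) ?_, ?_⟩
  · rw [pd_congr hDw i, pd_mul hf hw, hfx, zero_mul, add_zero]
    exact mul_ne_zero hi hwx
  · filter_upwards [hDw, hfψ, hw.continuousAt.eventually_ne hwx] with y h1 h2 h3
    rw [h1, ← h2, pow_eq_zero_iff hm, mul_eq_zero, or_iff_left h3]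

theorem eventually_eq_zero_imp_eq_of_cn_one {ψ : Cn 1 → ℂ} (hψ : ContDiffAt ℂ ∞ ψ 0)
    (hne : ∃ᶠ x in 𝓝 0, ψ x ≠ 0) : ∀ᶠ x in 𝓝 0, ψ x = 0 → x = 0 := by
  have hline : ∀ x : Cn 1, (0 : Cn 1) + x 0 • Pi.single 0 1 = x := fun x => by
    ext i
    fin_cases i
    simp
  have ht : Tendsto (fun x : Cn 1 => x 0) (𝓝 0) (𝓝 0) := by
    simpa using (continuous_apply (A := fun _ : Fin 1 => ℂ) 0).tendsto 0
  rcases (hψ.analyticAt_comp_line (Pi.single 0 1)).eventually_eq_zero_or_eventually_ne_zero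
    with h | h
  · refine absurd hne (Filter.not_frequently.2 ?_)
    filter_upwards [ht.eventually h] with x hx
    rw [hline] at hx
    exact not_not.2 hx
  · rw [eventually_nhdsWithin_iff] at h
    filter_upwards [ht.eventually h] with x hx hx0
    by_contra hne0
    refine hx (fun h0 => hne0 ?_) (by rwa [hline])
    rw [← hline x, h0, zero_smul, add_zero]

theorem smoothPointAt_of_eventually {n : ℕ} {X : Set (Cn n)} {p : Cn n} {φ : Cn n → ℂ}
    (hφ : AnalyticAt ℂ φ p) (hd : fderiv ℂ φ p ≠ 0) (hX : ∀ᶠ x in 𝓝 p, x ∈ X ↔ φ x = 0) :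
    SmoothPointAt X p := by
  obtain ⟨V, hV, hVo, hpV⟩ := eventually_nhds_iff.1 (hφ.eventually_analyticAt.and hX)
  refine ⟨V, φ, hVo, hpV, fun x hx => (hV x hx).1, hd, ?_⟩
  ext x
  constructor
  · rintro ⟨h1, h2⟩
    exact ⟨h2, (hV x h2).2.1 h1⟩
  · rintro ⟨h1, h2⟩
    exact ⟨(hV x h1).2.2 h2, h1⟩

theorem SmoothPointAt.exists_eventually {n : ℕ} {X : Set (Cn n)} {p : Cn n}
    (h : SmoothPointAt X p) : ∃ φ : Cn n → ℂ, ContDiffAt ℂ ∞ φ p ∧ fderiv ℂ φ p ≠ 0 ∧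
      ∀ᶠ x in 𝓝 p, x ∈ X ↔ φ x = 0 := by
  obtain ⟨V, φ, hVo, hpV, hφ, hd, hX⟩ := h
  refine ⟨φ, (hφ p hpV).contDiffAt, hd, ?_⟩
  filter_upwards [hVo.mem_nhds hpV] with x hx
  have := Set.ext_iff.1 hX x
  simpa [hx] using this

theorem IsHypersurfaceIn.exists_eventually {n : ℕ} {W X : Set (Cn n)}
    (h : IsHypersurfaceIn W X) {p : Cn n} (hp : p ∈ W) : ∃ ψ : Cn n → ℂ, AnalyticAt ℂ ψ p ∧
      (∃ᶠ x in 𝓝 p, ψ x ≠ 0) ∧ ∀ᶠ x in 𝓝 p, x ∈ X ↔ ψ x = 0 := by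
  obtain ⟨V, hVo, hVc, hpV, -, ψ, hψ, ⟨x, hxV, hx⟩, hX⟩ := h.2 p hp
  refine ⟨ψ, hψ p hpV, fun h0 => hx ?_, ?_⟩
  · exact hψ.eqOn_zero_of_preconnected_of_eventuallyEq_zero hVc hpV
      (h0.mono fun y hy => not_not.1 hy) hxV
  · filter_upwards [hVo.mem_nhds hpV] with y hy
    have := Set.ext_iff.1 hX y
    simpa [hy] using this

end

/-- Let `g : (ℂⁿ, 0) → (ℂⁿ, 0)` be (a representative of) a germ of a finite holomorphic
map.  Let `X` be (a representative of) a germ of an analytic hypersurface that has an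
isolated singularity at `0` (it is singular at `0` and smooth at every other point of
the representative).  Then the preimage `g⁻¹(X)` is singular at `0`. -/
theorem preimage_isolated_singularity_singular
    {n : ℕ} (g : Cn n → Cn n) (U W : Set (Cn n))
    (hUopen : IsOpen U) (hU0 : (0 : Cn n) ∈ U)
    (hWopen : IsOpen W) (hW0 : (0 : Cn n) ∈ W)
    (hghol : AnalyticOnNhd ℂ g U) (hmaps : MapsTo g U W) (hg0 : g 0 = 0)
    (hfin : U ∩ g ⁻¹' {0} = {0})
    (X : Set (Cn n)) (hX : IsHypersurfaceIn W X) (hX0 : (0 : Cn n) ∈ X)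
    (hXsing : ¬ SmoothPointAt X 0)
    (hisolated : ∀ x ∈ X, x ≠ 0 → SmoothPointAt X x) :
    ¬ SmoothPointAt (U ∩ g ⁻¹' X) 0 := by
  intro hsm
  obtain ⟨φ, hφ, hdφ, hzφ⟩ := hsm.exists_eventually
  obtain ⟨ψ, hψ, hne, hzψ⟩ := hX.exists_eventually hW0
  obtain ⟨i, hi⟩ := exists_pd_ne_zero hdφ
  have hUev : ∀ᶠ y in 𝓝 0, y ∈ U := hUopen.mem_nhds hU0
  have hgc : ContDiffAt ℂ (⊤ : ℕ∞) g 0 := (hghol 0 hU0).contDiffAt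
  have hψc : ContDiffAt ℂ (⊤ : ℕ∞) ψ 0 := hψ.contDiffAt
  have htg : Tendsto g (𝓝 0) (𝓝 0) := by simpa [hg0] using hgc.continuousAt.tendsto
  have hiso : ∀ᶠ y in 𝓝 0, g y = 0 → y = 0 := by
    filter_upwards [hUev] with y hy h
    exact hfin.subset ⟨hy, h⟩
  have hφ0 : φ 0 = 0 := hzφ.self_of_nhds.1 ⟨hU0, by rwa [mem_preimage, hg0]⟩
  have hz : ∀ᶠ y in 𝓝 0, ψ (g y) = 0 ↔ φ y = 0 := by
    filter_upwards [hUev, hzφ, htg.eventually hzψ] with y h1 h2 h3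
    rw [← h2, ← h3]
    exact ⟨fun h => ⟨h1, h⟩, fun h => h.2⟩
  obtain rfl | hn : n = 1 ∨ 2 ≤ n := by have := i.pos; omega
  · refine hXsing (smoothPointAt_of_eventually (φ := fun x => x 0) ?_
      (fderiv_ne_zero_of_pd_ne_zero (i := 0) (by simp [pd_coord])) ?_)
    · exact (ContinuousLinearMap.proj (R := ℂ) (φ := fun _ : Fin 1 => ℂ) 0).analyticAt 0
    · filter_upwards [eventually_eq_zero_imp_eq_of_cn_one hψc hne, hzψ] with x h1 h2
      refine ⟨fun h => by rw [h1 (h2.1 h), Pi.zero_apply], fun h => ?_⟩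
      rwa [show x = 0 from funext fun j => by rw [Subsingleton.elim j 0, h, Pi.zero_apply]]
  · obtain ⟨m, hm, hpow⟩ := not_singular_of_preimage hn hgc hg0 hiso hφ hφ0 hi hψc hne hz (by
      filter_upwards [eventually_eventually_nhds.2 hzψ, hψc.eventually_infty]
        with x h1 h2 h3 h4
      have hxX := h1.self_of_nhds.2 h4
      obtain ⟨l, hl, hdl, hzl⟩ := (hisolated x hxX h3).exists_eventually
      obtain ⟨j, hj⟩ := exists_pd_ne_zero hdl
      have hlx := hzl.self_of_nhds.1 hxX
      obtain ⟨k, s, hk, hs, hsx, hsj, hψs⟩ := exists_eq_pow_of_zeros h2 hl hlx hj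
        (by filter_upwards [h1, hzl] with y h5 h6 using h5.symm.trans h6)
      exact ⟨k, hk, s, j, hs, hsx, hsj, hψs.mono fun y h => h.symm⟩)
    obtain ⟨θ, hθ, hdθ, hzθ⟩ := hpow.exists_analyticAt hm hψ
    exact hXsing (smoothPointAt_of_eventually hθ hdθ
      (by filter_upwards [hzψ, hzθ] with y h1 h2 using h1.trans h2.symm))
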